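/- arXiv:2602.12632 — 3 statements merged into one kernel-verified Lean document; each statement's English description precedes it below -/
import Mathlib

section
/- For every integer n ≥ 1 and every instance with pairwise distinct values 1 ≥ x_1 > x_2 > … > x_n ≥ 0, the best-only pricing curve with threshold function f(t) = exp(−t/0.611) has regret at most 0.23. -/
open MeasureTheory

/-- The value received by the best-only pricing-curve algorithm with threshold function `f`
on the instance `x`, when value `x i` arrives at time `t i`: it accepts (and receives) the
value `x i` with the smallest arrival time among all indices `i` satisfying both
`x i ≥ f (t i)` and `x i > x j` for every `j` arriving before `i`; it receives `0` if no
index qualifies. -/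
noncomputable def bestOnlyReceived {n : ℕ} (f : ℝ → ℝ) (x t : Fin n → ℝ) : ℝ :=
  if h : (Finset.univ.filter fun i : Fin n =>
      f (t i) ≤ x i ∧ ∀ j, t j < t i → x j < x i).Nonempty then
    x (Classical.choose (Finset.exists_min_image _ t h))
  else 0

/-- The regret of the best-only pricing curve with threshold function `f` on the instance
`x 0 ≥ x 1 ≥ … ≥ x n`: the top value `x 0` minus the expected received value, where the
arrival times are i.i.d. uniform on `[0,1]`. -/
noncomputable def bestOnlyRegret {n : ℕ} (f : ℝ → ℝ) (x : Fin (n + 1) → ℝ) : ℝ :=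
  x 0 - ∫ t in Set.univ.pi (fun _ : Fin (n + 1) => Set.Icc (0 : ℝ) 1), bestOnlyReceived f x t

lemma pow_mul_sub_div_le {k : ℕ} (hk : 1 ≤ k) {v w : ℝ} (hv : 0 ≤ v) (hw : 0 ≤ w) :
    v ^ k * (w - v) / k ≤ ((k : ℝ) / (k + 1)) ^ (k + 1) / (k : ℝ) ^ 2 * w ^ (k + 1) := by
  have hk0 : (0 : ℝ) < k := by exact_mod_cast hk
  rcases hv.eq_or_lt with rfl | hv
  · rw [zero_pow (by omega)]
    simp only [zero_mul, zero_div]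
    positivity
  · have hb := one_add_mul_le_pow (a := k * w / ((k + 1) * v) - 1)
      (by have : 0 ≤ k * w / ((k + 1) * v) := by positivity
          linarith) (k + 1)
    have e1 : 1 + ((k + 1 : ℕ) : ℝ) * (k * w / ((k + 1) * v) - 1) = k * (w - v) / v := by
      push_cast
      field_simp
      ring
    rw [e1, add_sub_cancel] at hb
    have hb' := mul_le_mul_of_nonneg_left hb (by positivity : 0 ≤ v ^ (k + 1) / (k : ℝ) ^ 2)
    calc v ^ k * (w - v) / k = v ^ (k + 1) / (k : ℝ) ^ 2 * (k * (w - v) / v) := by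
          field_simp
          ring
      _ ≤ _ := hb'
      _ = _ := by
          rw [div_pow, div_pow, mul_pow, mul_pow]
          field_simp

lemma div_add_one_pow_succ_le (k : ℕ) :
    (((k + 1 : ℕ) : ℝ) / ((k + 1 : ℕ) + 1)) ^ (k + 1) ≤ ((k : ℝ) / (k + 1)) ^ k := by
  rcases Nat.eq_zero_or_pos k with rfl | hk
  · norm_num
  have hk0 : (0 : ℝ) < k := by exact_mod_cast hk
  have h := pow_mul_sub_div_le hk (v := ((k : ℝ) + 1) ^ 2 / (k * (k + 2)) * (k / (k + 1)))
    (w := 1) (by positivity) (by norm_num)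
  have e : 1 - ((k : ℝ) + 1) ^ 2 / (k * (k + 2)) * (k / (k + 1)) = 1 / (k + 2) := by
    field_simp
    ring
  have e2 : ((k : ℝ) + 1) ^ 2 / (k * (k + 2)) * (k / (k + 1)) = (k + 1) / (k + 2) := by
    field_simp
  rw [e, e2, one_pow, mul_one] at h
  have h2 := mul_le_mul_of_nonneg_left h (by positivity : 0 ≤ (k : ℝ) * (k + 1))
  have e3 : (k : ℝ) * (k + 1) * (((k + 1) / (k + 2)) ^ k * (1 / (k + 2)) / k)
      = (((k + 1 : ℕ) : ℝ) / ((k + 1 : ℕ) + 1)) ^ (k + 1) := by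
    push_cast
    rw [pow_succ, show (k : ℝ) + 1 + 1 = k + 2 by ring]
    field_simp
  have e4 : (k : ℝ) * (k + 1) * (((k : ℝ) / (k + 1)) ^ (k + 1) / (k : ℝ) ^ 2)
      = ((k : ℝ) / (k + 1)) ^ k := by
    rw [pow_succ]
    field_simp
  linarith

lemma div_add_one_pow_le_of_le {m k : ℕ} (h : m ≤ k) :
    ((k : ℝ) / (k + 1)) ^ k ≤ ((m : ℝ) / (m + 1)) ^ m :=
  antitone_nat_of_succ_le (f := fun k : ℕ => ((k : ℝ) / (k + 1)) ^ k) div_add_one_pow_succ_le h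

lemma sum_pow_mul_sub_div_tail_le (v : ℕ → ℝ) (hv : ∀ j, 0 ≤ v j) {w : ℝ} (hw0 : 0 ≤ w)
    (hw1 : w ≤ 1) (N : ℕ) :
    ∑ j ∈ Finset.range N, v (j + 7) ^ (j + 8) * (w - v (j + 7)) / ((j + 8 : ℕ) : ℝ)
      ≤ (8 / 9 : ℝ) ^ 8 / 8 * w ^ 9 := by
  have h : ∀ j ∈ Finset.range N,
      v (j + 7) ^ (j + 8) * (w - v (j + 7)) / ((j + 8 : ℕ) : ℝ)
        ≤ (8 / 9 : ℝ) ^ 8 * w ^ 9 * (1 / ((j : ℝ) + 8) - 1 / (((j + 1 : ℕ) : ℝ) + 8)) := by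
    intro j _
    refine (pow_mul_sub_div_le (by omega) (hv _) hw0).trans ?_
    have h1 := div_add_one_pow_le_of_le (show 8 ≤ j + 8 by omega)
    have h2 : w ^ (j + 8 + 1) ≤ w ^ 9 := pow_le_pow_of_le_one hw0 hw1 (by omega)
    have e : (((j + 8 : ℕ) : ℝ) / ((j + 8 : ℕ) + 1)) ^ (j + 8 + 1) / ((j + 8 : ℕ) : ℝ) ^ 2
        = (((j + 8 : ℕ) : ℝ) / ((j + 8 : ℕ) + 1)) ^ (j + 8)
          * (1 / ((j : ℝ) + 8) - 1 / (((j + 1 : ℕ) : ℝ) + 8)) := by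
      rw [pow_succ]
      push_cast
      have : (j : ℝ) + 8 ≠ 0 := by positivity
      have : (j : ℝ) + 8 + 1 ≠ 0 := by positivity
      have : (j : ℝ) + 1 + 8 ≠ 0 := by positivity
      field_simp
      ring
    rw [e]
    have h3 : 0 ≤ 1 / ((j : ℝ) + 8) - 1 / (((j + 1 : ℕ) : ℝ) + 8) := by
      push_cast
      rw [sub_nonneg]
      apply one_div_le_one_div_of_le <;> [positivity; linarith]
    have h1' : (((j + 8 : ℕ) : ℝ) / ((j + 8 : ℕ) + 1)) ^ (j + 8) ≤ (8 / 9 : ℝ) ^ 8 := by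
      refine h1.trans (le_of_eq ?_)
      norm_num
    calc _ ≤ (8 / 9 : ℝ) ^ 8 * (1 / ((j : ℝ) + 8) - 1 / (((j + 1 : ℕ) : ℝ) + 8)) * w ^ 9 := by
          gcongr
      _ = _ := by ring
  refine (Finset.sum_le_sum h).trans ?_
  rw [← Finset.mul_sum, Finset.sum_range_sub' (fun j : ℕ => 1 / ((j : ℝ) + 8))]
  have : 0 ≤ 1 / ((N : ℝ) + 8) := by positivity
  have h9 : 0 ≤ (8 / 9 : ℝ) ^ 8 * w ^ 9 := by positivity
  have := mul_nonneg h9 this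
  simp only [Nat.cast_zero, zero_add]
  nlinarith

lemma two_mul_sub_one_sq_mul_add_le {w : ℝ} (h0 : 1 / 2 ≤ w) (h1 : w ≤ 1) :
    (2 * w - 1) ^ 2 * (1 - w) + 9 / 256 * w ^ 4 + 64 / 3125 * w ^ 5 + 625 / 46656 * w ^ 6
      + 7776 / 823543 * w ^ 7 + 117649 / 16777216 * w ^ 8 + (8 / 9) ^ 8 / 8 * w ^ 9 ≤ 0.138 := by
  have key : ∀ l r : ℝ, l ≤ w → w ≤ r → ∀ i j : ℕ, 0 ≤ (w - l) ^ i * (r - w) ^ j :=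
    fun l r hl hr i j => mul_nonneg (pow_nonneg (by linarith) _) (pow_nonneg (by linarith) _)
  rcases le_total w (3 / 4) with h | h
  · have k := key _ _ h0 h
    linarith [k 0 9, k 1 8, k 2 7, k 3 6, k 4 5, k 5 4, k 6 3, k 7 2, k 8 1, k 9 0]
  rcases le_total w (7 / 8) with h' | h'
  · have k := key _ _ h h'
    linarith [k 0 9, k 1 8, k 2 7, k 3 6, k 4 5, k 5 4, k 6 3, k 7 2, k 8 1, k 9 0]
  · have k := key _ _ h' h1
    linarith [k 0 9, k 1 8, k 2 7, k 3 6, k 4 5, k 5 4, k 6 3, k 7 2, k 8 1, k 9 0]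

lemma entropy_poly_le_exp {u : ℝ} (h0 : 0 ≤ u) (h1 : u ≤ 1) :
    0.611 * (1 - u) + 2 / 27 * u ^ 3 + 9 / 256 * u ^ 4 + (0.138 - 2 / 27 - 9 / 256) * u ^ 5
      ≤ 0.23 * 0.611 * Real.exp ((1 - u) / 0.611) := by
  have hexp := Real.sum_le_exp_of_nonneg (x := (1 - u) / 0.611)
    (div_nonneg (by linarith) (by norm_num)) 7
  refine le_trans ?_ (mul_le_mul_of_nonneg_left hexp (by norm_num))
  simp only [Finset.sum_range_succ, Finset.sum_range_zero, Nat.factorial]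
  have key : ∀ l r : ℝ, l ≤ u → u ≤ r → ∀ i j : ℕ, 0 ≤ (u - l) ^ i * (r - u) ^ j :=
    fun l r hl hr i j => mul_nonneg (pow_nonneg (by linarith) _) (pow_nonneg (by linarith) _)
  norm_num
  rcases le_total u (1 / 2) with h | h
  · have k := key _ _ h0 h
    linarith [k 0 6, k 1 5, k 2 4, k 3 3, k 4 2, k 5 1, k 6 0]
  · have k := key _ _ h h1
    linarith [k 0 6, k 1 5, k 2 4, k 3 3, k 4 2, k 5 1, k 6 0]

/-- The gap between the mean of the first `j` terms and the term of index `j`, weighted by the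
`(j + 1)`-st power of that term over `j + 1`. -/
noncomputable def weightedGap (v : ℕ → ℝ) (j : ℕ) : ℝ :=
  v j ^ (j + 1) * ((∑ i ∈ Finset.range j, v i) / j - v j) / ((j + 1 : ℕ) : ℝ)

lemma le_mean_of_antitone {v : ℕ → ℝ} (hv : Antitone v) {j : ℕ} (hj : 1 ≤ j) :
    v j ≤ (∑ i ∈ Finset.range j, v i) / j := by
  have hj0 : (0 : ℝ) < j := by exact_mod_cast hj
  rw [le_div_iff₀ hj0]
  have := Finset.card_nsmul_le_sum (Finset.range j) v (v j)
    fun i hi => hv (Finset.mem_range.1 hi).le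
  simpa [mul_comm] using this

lemma weightedGap_nonneg {v : ℕ → ℝ} (hv : Antitone v) (h0 : ∀ j, 0 ≤ v j) {j : ℕ}
    (hj : 1 ≤ j) : 0 ≤ weightedGap v j :=
  div_nonneg (mul_nonneg (pow_nonneg (h0 j) _) (sub_nonneg.2 (le_mean_of_antitone hv hj)))
    (by positivity)

lemma mean_le_mean_two {v : ℕ → ℝ} (hv : Antitone v) {j : ℕ} (hj : 2 ≤ j) :
    (∑ i ∈ Finset.range j, v i) / j ≤ (v 0 + v 1) / 2 := by
  induction j, hj using Nat.le_induction with
  | base => simp [Finset.sum_range_succ]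
  | succ j hj ih =>
    refine le_trans ?_ ih
    have hj0 : (0 : ℝ) < j := by exact_mod_cast (by omega : 0 < j)
    have h := le_mean_of_antitone hv (show 1 ≤ j by omega)
    rw [Finset.sum_range_succ, div_le_div_iff₀ (by positivity) hj0]
    rw [le_div_iff₀ hj0] at h
    push_cast
    nlinarith

lemma weightedGap_le {v : ℕ → ℝ} (hv : Antitone v) (h0 : ∀ j, 0 ≤ v j) {j : ℕ} (hj : 2 ≤ j) :
    weightedGap v j ≤ v j ^ (j + 1) * ((v 0 + v 1) / 2 - v j) / ((j + 1 : ℕ) : ℝ) := by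
  have := mean_le_mean_two hv hj
  have := h0 j
  unfold weightedGap
  gcongr

lemma sum_weightedGap_le {v : ℕ → ℝ} (hv : Antitone v) (h0 : ∀ j, 0 ≤ v j) (hv0 : v 0 = 1)
    (N : ℕ) : ∑ j ∈ Finset.range N, weightedGap v (j + 1) ≤ 0.138 := by
  have hmono : ∑ j ∈ Finset.range N, weightedGap v (j + 1)
      ≤ ∑ j ∈ Finset.range (6 + N), weightedGap v (j + 1) :=
    Finset.sum_le_sum_of_subset_of_nonneg (Finset.range_mono (by omega))
      fun j _ _ => weightedGap_nonneg hv h0 (by omega)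
  refine hmono.trans ?_
  have h1 := h0 1
  have h1' : v 1 ≤ 1 := hv0 ▸ hv (Nat.zero_le 1)
  set w := (v 0 + v 1) / 2 with hw
  have hw0 : 0 ≤ w := by rw [hw, hv0]; linarith
  have hw1 : w ≤ 1 := by rw [hw, hv0]; linarith
  have e1 : weightedGap v 1 = (2 * w - 1) ^ 2 * (1 - w) := by
    simp [weightedGap, hw, hv0]
    ring
  have tail : ∑ j ∈ Finset.range N, weightedGap v (6 + j + 1) ≤ (8 / 9 : ℝ) ^ 8 / 8 * w ^ 9 := by
    refine le_trans (Finset.sum_le_sum fun j _ => ?_) (sum_pow_mul_sub_div_tail_le v h0 hw0 hw1 N)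
    have := weightedGap_le hv h0 (show 2 ≤ 6 + j + 1 by omega)
    rwa [show 6 + j + 1 = j + 7 by omega] at this ⊢
  have g : ∀ j : ℕ, 2 ≤ j → weightedGap v j ≤
      (((j + 1 : ℕ) : ℝ) / ((j + 1 : ℕ) + 1)) ^ (j + 1 + 1) / ((j + 1 : ℕ) : ℝ) ^ 2
        * w ^ (j + 1 + 1) :=
    fun j hj => (weightedGap_le hv h0 hj).trans (pow_mul_sub_div_le (by omega) (h0 j) hw0)
  have g2 := g 2 (by norm_num)
  have g3 := g 3 (by norm_num)
  have g4 := g 4 (by norm_num)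
  have g5 := g 5 (by norm_num)
  have g6 := g 6 (by norm_num)
  have hp := two_mul_sub_one_sq_mul_add_le (w := w) (by rw [hw, hv0]; linarith) hw1
  rw [Finset.sum_range_add]
  simp only [Finset.sum_range_succ, Finset.sum_range_zero, zero_add, Nat.reduceAdd, e1]
  norm_num at g2 g3 g4 g5 g6 hp tail ⊢
  linarith

lemma weightedGap_one_le {v : ℕ → ℝ} (hv0 : v 0 = 1) (h1 : 0 ≤ v 1) :
    weightedGap v 1 ≤ 2 / 27 := by
  have h := pow_mul_sub_div_le (k := 2) (by norm_num) h1 (zero_le_one' ℝ)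
  simp only [weightedGap, Finset.sum_range_succ, Finset.sum_range_zero, hv0]
  norm_num at h ⊢
  linarith

lemma weightedGap_two_le {v : ℕ → ℝ} (hv : Antitone v) (h0 : ∀ j, 0 ≤ v j) (hv0 : v 0 = 1) :
    weightedGap v 2 ≤ 9 / 256 := by
  refine (weightedGap_le hv h0 le_rfl).trans ?_
  have h1' : v 1 ≤ 1 := hv0 ▸ hv (Nat.zero_le 1)
  have h := pow_mul_sub_div_le (k := 3) (by norm_num) (h0 2) (zero_le_one' ℝ)
  have h3 : v 2 ^ 3 * ((v 0 + v 1) / 2 - v 2) ≤ v 2 ^ 3 * (1 - v 2) :=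
    mul_le_mul_of_nonneg_left (by linarith) (pow_nonneg (h0 2) _)
  norm_num at h h3 ⊢
  linarith

lemma sum_pow_mul_weightedGap_le {v : ℕ → ℝ} (hv : Antitone v) (h0 : ∀ j, 0 ≤ v j)
    (hv0 : v 0 = 1) {u : ℝ} (hu0 : 0 ≤ u) (hu1 : u ≤ 1) (N : ℕ) :
    ∑ j ∈ Finset.range N, u ^ (j + 3) * weightedGap v (j + 1)
      ≤ 2 / 27 * u ^ 3 + 9 / 256 * u ^ 4 + (0.138 - 2 / 27 - 9 / 256) * u ^ 5 := by
  have hτ : ∀ j, 0 ≤ weightedGap v (j + 1) := fun j => weightedGap_nonneg hv h0 (by omega)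
  have hmono : ∑ j ∈ Finset.range N, u ^ (j + 3) * weightedGap v (j + 1)
      ≤ ∑ j ∈ Finset.range (2 + N), u ^ (j + 3) * weightedGap v (j + 1) :=
    Finset.sum_le_sum_of_subset_of_nonneg (Finset.range_mono (by omega))
      fun j _ _ => mul_nonneg (by positivity) (hτ j)
  refine hmono.trans ?_
  have hs := sum_weightedGap_le hv h0 hv0 (2 + N)
  have tail : ∑ j ∈ Finset.range N, u ^ (2 + j + 3) * weightedGap v (2 + j + 1)
      ≤ u ^ 5 * ∑ j ∈ Finset.range N, weightedGap v (2 + j + 1) := by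
    rw [Finset.mul_sum]
    exact Finset.sum_le_sum fun j _ => mul_le_mul_of_nonneg_right
      (pow_le_pow_of_le_one hu0 hu1 (by omega)) (by rw [Nat.add_assoc]; exact hτ _)
  rw [Finset.sum_range_add] at hs ⊢
  simp only [Finset.sum_range_succ, Finset.sum_range_zero, zero_add, Nat.reduceAdd] at hs ⊢
  have t1 := weightedGap_one_le hv0 (h0 1)
  have t2 := weightedGap_two_le hv h0 hv0
  have u5 : 0 ≤ u ^ 5 := by positivity
  have u35 : u ^ 5 ≤ u ^ 3 := pow_le_pow_of_le_one hu0 hu1 (by norm_num)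
  have u45 : u ^ 5 ≤ u ^ 4 := pow_le_pow_of_le_one hu0 hu1 (by norm_num)
  have m1 := mul_le_mul_of_nonneg_left hs u5
  have m2 := mul_nonneg (sub_nonneg.2 t1) (sub_nonneg.2 u35)
  have m3 := mul_nonneg (sub_nonneg.2 t2) (sub_nonneg.2 u45)
  linarith

/-- The bound on the regret once the acceptance probabilities `A j` are known to be controlled by
`1 + 0.611 * log (X j)`. -/
lemma regret_bound {X A : ℕ → ℝ} (hX : Antitone X) (hX1 : X 0 ≤ 1)
    (hA0 : ∀ j, 0 ≤ A j) (hA : ∀ j, 0 < A j → 0 < X j ∧ A j ≤ 1 + 0.611 * Real.log (X j))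
    (hA1 : 0 < X 0 → 1 + 0.611 * Real.log (X 0) ≤ A 0) (N : ℕ) :
    X 0 * (1 - A 0) + ∑ j ∈ Finset.range N, A (j + 1) ^ (j + 2) / ((j + 2 : ℕ) : ℝ)
      * ((∑ i ∈ Finset.range (j + 1), X i) / ((j + 1 : ℕ) : ℝ) - X (j + 1)) ≤ 0.23 := by
  set u := 1 + 0.611 * Real.log (X 0) with hu
  by_cases hpos : 0 < X 0 ∧ 0 < u
  · obtain ⟨hx, hupos⟩ := hpos
    have hlog : Real.log (X 0) ≤ 0 := Real.log_nonpos hx.le hX1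
    have hu1 : u ≤ 1 := by linarith
    set v : ℕ → ℝ := fun j => max 0 (1 + 0.611 * (X j - X 0) / (X 0 * u)) with hv
    have hvanti : Antitone v := fun i j hij => by
      have := hX hij
      simp only [hv]
      gcongr
    have hv0 : ∀ j, 0 ≤ v j := fun j => le_max_left _ _
    have hvone : v 0 = 1 := by simp [hv]
    have hval : ∀ j, 0 < v j → X j = X 0 + X 0 * u / 0.611 * (v j - 1) := fun j hj => by
      have : v j = 1 + 0.611 * (X j - X 0) / (X 0 * u) := by
        rcases max_choice (0 : ℝ) (1 + 0.611 * (X j - X 0) / (X 0 * u)) with h | h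
        · exact absurd (show v j = 0 from h) hj.ne'
        · exact h
      rw [this]
      field_simp
      ring
    have hAv : ∀ j, A j ≤ u * v j := fun j => by
      rcases (hA0 j).eq_or_lt with h | h
      · rw [← h]
        exact mul_nonneg hupos.le (hv0 j)
      · obtain ⟨hj, hle⟩ := hA j h
        have h1 := Real.log_le_sub_one_of_pos (div_pos hj hx)
        rw [Real.log_div hj.ne' hx.ne'] at h1
        calc A j ≤ u * (1 + 0.611 * (X j - X 0) / (X 0 * u)) := by
              have : u * (1 + 0.611 * (X j - X 0) / (X 0 * u))
                  = u + 0.611 * (X j / X 0 - 1) := by field_simp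
              rw [this, hu]
              linarith
          _ ≤ u * v j := mul_le_mul_of_nonneg_left (le_max_right _ _) hupos.le
    have hterm : ∀ j ∈ Finset.range N, A (j + 1) ^ (j + 2) / ((j + 2 : ℕ) : ℝ)
        * ((∑ i ∈ Finset.range (j + 1), X i) / ((j + 1 : ℕ) : ℝ) - X (j + 1))
        ≤ X 0 / 0.611 * (u ^ (j + 3) * weightedGap v (j + 1)) := fun j _ => by
      rcases (hv0 (j + 1)).eq_or_lt with h | h
      · have hz : A (j + 1) = 0 := le_antisymm (by simpa [← h] using hAv (j + 1)) (hA0 _)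
        rw [hz, zero_pow (by omega), zero_div, zero_mul]
        exact mul_nonneg (by positivity)
          (mul_nonneg (by positivity) (weightedGap_nonneg hvanti hv0 (by omega)))
      · have hsum : ∑ i ∈ Finset.range (j + 1), X i
            = ∑ i ∈ Finset.range (j + 1), (X 0 + X 0 * u / 0.611 * (v i - 1)) :=
          Finset.sum_congr rfl fun i hi =>
            hval i (h.trans_le (hvanti (Finset.mem_range.1 hi).le))
        have hgap : (∑ i ∈ Finset.range (j + 1), X i) / ((j + 1 : ℕ) : ℝ) - X (j + 1)
            = X 0 * u / 0.611
              * ((∑ i ∈ Finset.range (j + 1), v i) / ((j + 1 : ℕ) : ℝ) - v (j + 1)) := by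
          rw [hsum, hval _ h, Finset.sum_add_distrib, ← Finset.mul_sum, Finset.sum_sub_distrib]
          simp only [Finset.sum_const, Finset.card_range, nsmul_eq_mul]
          have : ((j + 1 : ℕ) : ℝ) ≠ 0 := by positivity
          field_simp
          ring
        have hgap0 := le_mean_of_antitone hvanti (show 1 ≤ j + 1 by omega)
        have hAp : A (j + 1) ^ (j + 2) ≤ (u * v (j + 1)) ^ (j + 2) :=
          pow_le_pow_left₀ (hA0 _) (hAv _) _
        rw [hgap]
        calc _ ≤ (u * v (j + 1)) ^ (j + 2) / ((j + 2 : ℕ) : ℝ) * (X 0 * u / 0.611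
              * ((∑ i ∈ Finset.range (j + 1), v i) / ((j + 1 : ℕ) : ℝ) - v (j + 1))) := by
              have := sub_nonneg.2 hgap0
              gcongr
          _ = _ := by
              unfold weightedGap
              rw [mul_pow]
              ring
    have hS := sum_pow_mul_weightedGap_le hvanti hv0 hvone hupos.le hu1 N
    have hE := entropy_poly_le_exp hupos.le hu1
    have hexp : Real.exp ((1 - u) / 0.611) = 1 / X 0 := by
      rw [show (1 - u) / 0.611 = -Real.log (X 0) by rw [hu]; field_simp; ring, Real.exp_neg,
        Real.exp_log hx, one_div]
    rw [hexp] at hE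
    have hE' := mul_le_mul_of_nonneg_left hE (by positivity : 0 ≤ X 0 / 0.611)
    have e : X 0 / 0.611 * (0.23 * 0.611 * (1 / X 0)) = 0.23 := by field_simp
    rw [e] at hE'
    have hT := Finset.sum_le_sum hterm
    rw [← Finset.mul_sum] at hT
    have hS' := mul_le_mul_of_nonneg_left hS (by positivity : 0 ≤ X 0 / 0.611)
    have hfirst : X 0 * (1 - A 0) ≤ X 0 / 0.611 * (0.611 * (1 - u)) := by
      have := mul_le_mul_of_nonneg_left (sub_le_sub_left (hA1 hx) 1) hx.le
      refine this.trans (le_of_eq ?_)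
      field_simp
    have : X 0 / 0.611 * (0.611 * (1 - u) + 2 / 27 * u ^ 3 + 9 / 256 * u ^ 4
          + (0.138 - 2 / 27 - 9 / 256) * u ^ 5)
        = X 0 / 0.611 * (0.611 * (1 - u)) + X 0 / 0.611 * (2 / 27 * u ^ 3 + 9 / 256 * u ^ 4
          + (0.138 - 2 / 27 - 9 / 256) * u ^ 5) := by ring
    linarith
  · have hzero : ∀ j, A j = 0 := fun j => by
      by_contra hne
      obtain ⟨hj, hle⟩ := hA j (lt_of_le_of_ne (hA0 j) (Ne.symm hne))
      have h0j := hX (Nat.zero_le j)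
      have := Real.log_le_log hj h0j
      have hAj := lt_of_le_of_ne (hA0 j) (Ne.symm hne)
      exact hpos ⟨hj.trans_le h0j, by linarith⟩
    have hx : X 0 ≤ 0.23 := by
      by_contra! hlt
      have hx : 0 < X 0 := lt_trans (by norm_num) hlt
      have hu0 : u ≤ 0 := not_lt.1 fun h => hpos ⟨hx, h⟩
      have hE := entropy_poly_le_exp le_rfl zero_le_one
      have h1 : Real.exp ((1 - 0) / 0.611) ≤ 1 / X 0 := by
        rw [one_div, ← Real.exp_log hx, ← Real.exp_neg]
        apply Real.exp_le_exp.2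
        rw [div_le_iff₀ (by norm_num)]
        linarith
      rw [le_div_iff₀ hx] at h1
      norm_num at hE
      have h2 : 100 / 23 ≤ Real.exp ((1 - 0) / 0.611) := by norm_num; linarith
      nlinarith
    have : ∑ j ∈ Finset.range N, A (j + 1) ^ (j + 2) / ((j + 2 : ℕ) : ℝ)
        * ((∑ i ∈ Finset.range (j + 1), X i) / ((j + 1 : ℕ) : ℝ) - X (j + 1)) = 0 :=
      Finset.sum_eq_zero fun j _ => by
        rw [hzero, zero_pow (by omega), zero_div, zero_mul]
    rw [this, hzero]
    linarith

section OrderEvents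

variable {ι : Type*}

/-- The event that the coordinates in `S` all lie in `B`, the smallest of them being the one of
index `p` and the second smallest the one of index `q`. -/
def firstTwo (S : Finset ι) (B : Set ℝ) (p q : ι) : Set (ι → ℝ) :=
  {t | (∀ i ∈ S, t i ∈ B) ∧ t p < t q ∧ ∀ i ∈ S, i ≠ p → i ≠ q → t q < t i}

lemma measurableSet_forall_mem [Countable ι] (S : Finset ι) {B : Set ℝ} (hB : MeasurableSet B) :
    MeasurableSet {t : ι → ℝ | ∀ i ∈ S, t i ∈ B} := by
  simp only [Set.ofPred_forall]
  exact .iInter fun i => .iInter fun _ => measurable_pi_apply i hB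

lemma measurableSet_firstTwo [Countable ι] (S : Finset ι) {B : Set ℝ} (hB : MeasurableSet B) (p q : ι) :
    MeasurableSet (firstTwo S B p q) := by
  have h : MeasurableSet {t : ι → ℝ | ∀ i ∈ S, i ≠ p → i ≠ q → t q < t i} := by
    simp only [Set.ofPred_forall]
    exact .iInter fun i => .iInter fun _ => .iInter fun _ => .iInter fun _ =>
      measurableSet_lt (measurable_pi_apply q) (measurable_pi_apply i)
  exact (measurableSet_forall_mem S hB).inter
    ((measurableSet_lt (measurable_pi_apply p) (measurable_pi_apply q)).inter h)

lemma pairwiseDisjoint_firstTwo [DecidableEq ι] (S : Finset ι) (B : Set ℝ) :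
    (S.offDiag : Set (ι × ι)).PairwiseDisjoint fun r => firstTwo S B r.1 r.2 := by
  rintro ⟨p, q⟩ hr ⟨p', q'⟩ hr' hne
  simp only [Finset.mem_coe, Finset.mem_offDiag] at hr hr'
  refine Set.disjoint_left.2 ?_
  rintro t ⟨-, h1, h2⟩ ⟨-, h1', h2'⟩
  simp only at h1 h2 h1' h2'
  have hmin : ∀ i ∈ S, i ≠ p → t p < t i := fun i hi hip => by
    by_cases hiq : i = q
    · exact hiq ▸ h1
    · exact h1.trans (h2 i hi hip hiq)
  have hmin' : ∀ i ∈ S, i ≠ p' → t p' < t i := fun i hi hip => by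
    by_cases hiq : i = q'
    · exact hiq ▸ h1'
    · exact h1'.trans (h2' i hi hip hiq)
  have hp : p = p' := by
    by_contra h
    exact lt_asymm (hmin p' hr'.1 (Ne.symm h)) (hmin' p hr.1 h)
  subst hp
  have hq : q ≠ q' := fun h => hne (by rw [h])
  exact lt_asymm (h2 q' hr'.2.1 (Ne.symm hr'.2.2) (Ne.symm hq)) (h2' q hr.2.1 (Ne.symm hr.2.2) hq)

variable [Fintype ι] (μ : Measure ℝ) [IsProbabilityMeasure μ]

lemma pi_real_forall_mem (S : Finset ι) (B : Set ℝ) :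
    (Measure.pi fun _ : ι => μ).real {t | ∀ i ∈ S, t i ∈ B} = μ.real B ^ S.card := by
  classical
  have : {t : ι → ℝ | ∀ i ∈ S, t i ∈ B} = Set.univ.pi fun i => if i ∈ S then B else Set.univ := by
    ext t
    simp only [Set.mem_ofPred_eq, Set.mem_univ_pi]
    refine forall_congr' fun i => ?_
    split_ifs with h <;> simp [h]
  rw [this, measureReal_def, Measure.pi_pi, ENNReal.toReal_prod]
  simp_rw [apply_ite μ, apply_ite ENNReal.toReal, measure_univ, ENNReal.toReal_one]
  rw [Finset.prod_ite]
  simp [measureReal_def]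

lemma pi_real_firstTwo_perm {S : Finset ι} {B : Set ℝ} (hB : MeasurableSet B) (σ : Equiv.Perm ι)
    (hσ : ∀ i, σ i ∈ S ↔ i ∈ S) (p q : ι) :
    (Measure.pi fun _ : ι => μ).real (firstTwo S B (σ p) (σ q))
      = (Measure.pi fun _ : ι => μ).real (firstTwo S B p q) := by
  have h := measurePreserving_piCongrLeft (fun _ : ι => μ) σ
  rw [← h.measureReal_preimage (measurableSet_firstTwo S hB _ _).nullMeasurableSet]
  congr 1
  ext t
  have happ : ∀ i, (MeasurableEquiv.piCongrLeft (fun _ : ι => ℝ) σ) t (σ i) = t i :=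
    fun i => MeasurableEquiv.piCongrLeft_apply_apply ..
  simp only [firstTwo, Set.mem_preimage, Set.mem_ofPred_eq, happ]
  refine and_congr ?_ (and_congr_right fun _ => ?_)
  · rw [← σ.forall_congr_right]
    simp only [hσ, happ]
  · rw [← σ.forall_congr_right]
    simp only [hσ, happ, ne_eq, EmbeddingLike.apply_eq_iff_eq]

lemma pi_real_firstTwo_eq {S : Finset ι} {B : Set ℝ} (hB : MeasurableSet B) {p q p' q' : ι}
    (hp : p ∈ S) (hq : q ∈ S) (hp' : p' ∈ S) (hq' : q' ∈ S) (hpq : p ≠ q) (hpq' : p' ≠ q') :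
    (Measure.pi fun _ : ι => μ).real (firstTwo S B p' q')
      = (Measure.pi fun _ : ι => μ).real (firstTwo S B p q) := by
  classical
  have hswap : ∀ {a b : ι}, a ∈ S → b ∈ S → ∀ i, Equiv.swap a b i ∈ S ↔ i ∈ S := by
    intro a b ha hb i
    rw [Equiv.swap_apply_def]
    split_ifs with h1 h2 <;> simp [*]
  have hr : Equiv.swap p p' q ∈ S := (hswap hp hp' q).2 hq
  have hrp : p' ≠ Equiv.swap p p' q := fun h => hpq <| by
    have := congrArg (Equiv.swap p p') h
    simpa using this
  have h1 := pi_real_firstTwo_perm μ hB (Equiv.swap p p') (hswap hp hp') p q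
  have h2 := pi_real_firstTwo_perm μ hB (Equiv.swap (Equiv.swap p p' q) q') (hswap hr hq') p'
    (Equiv.swap p p' q)
  rw [Equiv.swap_apply_left, Equiv.swap_apply_of_ne_of_ne hrp hpq'] at h2
  rw [Equiv.swap_apply_left] at h1
  rw [h2, h1]

lemma card_mul_pi_real_firstTwo_le {S : Finset ι} {B : Set ℝ} (hB : MeasurableSet B) {p q : ι}
    (hp : p ∈ S) (hq : q ∈ S) (hpq : p ≠ q) :
    (S.card * (S.card - 1) : ℝ) * (Measure.pi fun _ : ι => μ).real (firstTwo S B p q)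
      ≤ μ.real B ^ S.card := by
  classical
  rw [← pi_real_forall_mem (ι := ι) μ S B]
  have hU : (Measure.pi fun _ : ι => μ).real (⋃ r ∈ S.offDiag, firstTwo S B r.1 r.2)
      = ∑ r ∈ S.offDiag, (Measure.pi fun _ : ι => μ).real (firstTwo S B r.1 r.2) :=
    measureReal_biUnion_finset (pairwiseDisjoint_firstTwo S B)
      fun r _ => measurableSet_firstTwo S hB _ _
  have hc : ∀ r ∈ S.offDiag, (Measure.pi fun _ : ι => μ).real (firstTwo S B r.1 r.2)
      = (Measure.pi fun _ : ι => μ).real (firstTwo S B p q) := fun r hr => by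
    obtain ⟨h1, h2, h3⟩ := Finset.mem_offDiag.1 hr
    exact pi_real_firstTwo_eq μ hB hp hq h1 h2 hpq h3
  rw [Finset.sum_congr rfl hc, Finset.sum_const, Finset.offDiag_card, nsmul_eq_mul,
    Nat.cast_sub (Nat.le_mul_self _)] at hU
  push_cast at hU
  rw [mul_sub_one, ← hU]
  refine measureReal_mono ?_
  exact Set.iUnion₂_subset fun r _ t ht => ht.1

end OrderEvents

open Classical in
/-- The value accepted among the first `m` items of a decreasing instance `X` with arrival times
`T`, computed by adding the items from the largest to the smallest: a new smallest item is
accepted exactly when it passes the threshold and arrives before all the others. -/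
noncomputable def prefixReceived (f : ℝ → ℝ) (X T : ℕ → ℝ) : ℕ → ℝ
  | 0 => 0
  | m + 1 => if f (T m) ≤ X m ∧ ∀ j < m, T m < T j then X m else prefixReceived f X T m

lemma prefixReceived_eq {f : ℝ → ℝ} {X T : ℕ → ℝ} {i m : ℕ} (him : i < m) (hf : f (T i) ≤ X i)
    (hi : ∀ j < i, T i < T j)
    (hl : ∀ l, i < l → l < m → ¬(f (T l) ≤ X l ∧ ∀ j < l, T l < T j)) :
    prefixReceived f X T m = X i := by
  induction m, him using Nat.le_induction with
  | base => exact if_pos ⟨hf, hi⟩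
  | succ m hm ih =>
    rw [prefixReceived, if_neg (hl m hm (by omega))]
    exact ih fun l h1 h2 => hl l h1 (by omega)

lemma prefixReceived_eq_zero {f : ℝ → ℝ} {X T : ℕ → ℝ} {m : ℕ}
    (h : ∀ l < m, ¬(f (T l) ≤ X l ∧ ∀ j < l, T l < T j)) : prefixReceived f X T m = 0 := by
  induction m with
  | zero => rfl
  | succ m ih =>
    rw [prefixReceived, if_neg (h m (by omega))]
    exact ih fun l hl => h l (by omega)

/-- The index `k` truncated to an element of `Fin (n + 1)`. -/
def truncIdx (n k : ℕ) : Fin (n + 1) := ⟨min k n, Nat.lt_succ_of_le (min_le_right k n)⟩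

lemma truncIdx_val {n : ℕ} (i : Fin (n + 1)) : truncIdx n i = i :=
  Fin.ext (min_eq_left (Nat.lt_succ_iff.1 i.2))

lemma truncIdx_mono (n : ℕ) : Monotone (truncIdx n) := fun _ _ h => min_le_min_right n h

lemma bestOnlyReceived_eq {n : ℕ} (f : ℝ → ℝ) {x t : Fin (n + 1) → ℝ} (hx : StrictAnti x)
    (ht : Function.Injective t) :
    bestOnlyReceived f x t
      = prefixReceived f (fun k => x (truncIdx n k)) (fun k => t (truncIdx n k)) (n + 1) := by
  have hE : ∀ i : Fin (n + 1), (f (t i) ≤ x i ∧ ∀ j, t j < t i → x j < x i) ↔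
      (f (t (truncIdx n i)) ≤ x (truncIdx n i) ∧
        ∀ j < (i : ℕ), t (truncIdx n i) < t (truncIdx n j)) := fun i => by
    rw [truncIdx_val]
    refine and_congr_right fun _ => ⟨fun h j hj => ?_, fun h j hj => ?_⟩
    · obtain ⟨j, rfl⟩ : ∃ j' : Fin (n + 1), (j' : ℕ) = j := ⟨⟨j, hj.trans i.2⟩, rfl⟩
      rw [truncIdx_val]
      have hji : j < i := hj
      refine lt_of_le_of_ne (not_lt.1 fun hlt => ?_) fun he => hji.ne' (ht he)
      exact lt_asymm (h j hlt) (hx hji)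
    · refine hx (lt_of_not_ge fun hle => ?_)
      rcases hle.eq_or_lt with rfl | hlt
      · exact lt_irrefl _ hj
      · have := h j hlt
        rw [truncIdx_val] at this
        exact lt_asymm this hj
  unfold bestOnlyReceived
  split_ifs with h
  · obtain ⟨hmem, hmin⟩ := Classical.choose_spec (Finset.exists_min_image _ t h)
    set i := Classical.choose (Finset.exists_min_image _ t h)
    simp only [Finset.mem_filter, Finset.mem_univ, true_and] at hmem hmin
    have hi := (hE i).1 hmem
    rw [prefixReceived_eq i.2 hi.1 hi.2, truncIdx_val]
    intro l hil hl hEl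
    have hl' := hmin ⟨l, hl⟩ ((hE ⟨l, hl⟩).2 hEl)
    have := hEl.2 i hil
    rw [truncIdx_val, show truncIdx n l = ⟨l, hl⟩ from truncIdx_val (⟨l, hl⟩ : Fin (n + 1))] at this
    exact this.not_ge hl'
  · refine (prefixReceived_eq_zero fun l hl hEl => h ⟨⟨l, hl⟩, ?_⟩).symm
    simp only [Finset.mem_filter, Finset.mem_univ, true_and]
    exact (hE ⟨l, hl⟩).2 hEl

lemma prefixReceived_sub_le {n : ℕ} {f : ℝ → ℝ} (hf : Antitone f) {X : ℕ → ℝ} (hX : Antitone X)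
    {t : Fin (n + 1) → ℝ} (ht : Function.Injective t) {m : ℕ} (hm : 1 ≤ m) (hmn : m ≤ n) :
    prefixReceived f X (fun k => t (truncIdx n k)) m - ∑ j ∈ Finset.range m,
        (firstTwo (Finset.Iic (truncIdx n m)) {τ | f τ ≤ X m} (truncIdx n m)
          (truncIdx n j)).indicator (fun _ => X j - X m) t
      ≤ prefixReceived f X (fun k => t (truncIdx n k)) (m + 1) := by
  have hnonneg : ∀ j ∈ Finset.range m,
      0 ≤ (firstTwo (Finset.Iic (truncIdx n m)) {τ | f τ ≤ X m} (truncIdx n m)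
          (truncIdx n j)).indicator (fun _ => X j - X m) t := fun j hj =>
    Set.indicator_nonneg (fun _ _ => sub_nonneg.2 (hX (Finset.mem_range.1 hj).le)) _
  rw [prefixReceived]
  split_ifs with hE
  · obtain ⟨j, hj, hjmin⟩ := Finset.exists_min_image (Finset.range m)
      (fun k => t (truncIdx n k)) ⟨0, Finset.mem_range.2 hm⟩
    rw [Finset.mem_range] at hj
    have hinj : ∀ i < m, i ≠ j → t (truncIdx n j) < t (truncIdx n i) := fun i hi hij => by
      refine lt_of_le_of_ne (hjmin i (Finset.mem_range.2 hi)) fun he => hij ?_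
      have := congrArg Fin.val (ht he)
      simp only [truncIdx] at this
      omega
    have hlow : ∀ i < m, f (t (truncIdx n i)) ≤ X m := fun i hi =>
      (hf (hE.2 i hi).le).trans hE.1
    have hval : prefixReceived f X (fun k => t (truncIdx n k)) m = X j :=
      prefixReceived_eq hj ((hlow j hj).trans (hX hj.le))
        (fun i hi => hinj i (hi.trans hj) hi.ne)
        fun l hjl hl hEl => lt_asymm (hEl.2 j hjl) (hinj l hl hjl.ne')
    have hmem : t ∈ firstTwo (Finset.Iic (truncIdx n m)) {τ | f τ ≤ X m} (truncIdx n m)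
        (truncIdx n j) := by
      have hidx : ∀ i ∈ Finset.Iic (truncIdx n m), i ≠ truncIdx n m → (i : ℕ) < m :=
        fun i hi hne => by
          have h1 : i < truncIdx n m := lt_of_le_of_ne (Finset.mem_Iic.1 hi) hne
          exact (Fin.lt_def.1 h1).trans_le (min_le_left _ _)
      refine ⟨fun i hi => ?_, hE.2 j hj, fun i hi h1 h2 => ?_⟩
      · by_cases h1 : i = truncIdx n m
        · exact h1 ▸ hE.1
        · have := hlow i (hidx i hi h1)
          rw [truncIdx_val] at this
          exact this
      · have := hinj i (hidx i hi h1) fun h => h2 (by rw [← h, truncIdx_val])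
        rwa [truncIdx_val] at this
    have := Finset.single_le_sum hnonneg (Finset.mem_range.2 hj)
    rw [Set.indicator_of_mem hmem] at this
    rw [hval]
    linarith
  · have := Finset.sum_nonneg hnonneg
    linarith

lemma measurable_prefixReceived (n : ℕ) {f : ℝ → ℝ} (hf : Measurable f) (X : ℕ → ℝ) (m : ℕ) :
    Measurable fun t : Fin (n + 1) → ℝ =>
      prefixReceived f X (fun k => t (truncIdx n k)) m := by
  induction m with
  | zero => exact measurable_const
  | succ m ih =>
    refine Measurable.ite ?_ measurable_const ih
    have h1 : MeasurableSet {t : Fin (n + 1) → ℝ | f (t (truncIdx n m)) ≤ X m} :=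
      measurableSet_le (hf.comp (measurable_pi_apply _)) measurable_const
    have h2 : MeasurableSet {t : Fin (n + 1) → ℝ |
        ∀ j < m, t (truncIdx n m) < t (truncIdx n j)} := by
      simp only [Set.ofPred_forall]
      exact .iInter fun j => .iInter fun _ =>
        measurableSet_lt (measurable_pi_apply _) (measurable_pi_apply _)
    exact h1.inter h2

lemma abs_prefixReceived_le {f : ℝ → ℝ} {X : ℕ → ℝ} (hX : Antitone X) (hX0 : ∀ j, 0 ≤ X j)
    (T : ℕ → ℝ) (m : ℕ) : |prefixReceived f X T m| ≤ X 0 := by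
  induction m with
  | zero => simpa [prefixReceived] using hX0 0
  | succ m ih =>
    rw [prefixReceived]
    split_ifs
    · rw [abs_of_nonneg (hX0 m)]
      exact hX (Nat.zero_le m)
    · exact ih

lemma ae_injective_pi_restrict (n : ℕ) :
    ∀ᵐ t ∂(Measure.pi fun _ : Fin n => (volume : Measure ℝ).restrict (Set.Icc 0 1)),
      Function.Injective t := by
  rw [← Measure.restrict_pi_pi]
  refine ae_restrict_of_ae ?_
  have h : ∀ i j : Fin n, i ≠ j → ∀ᵐ t : Fin n → ℝ, t i ≠ t j := fun i j hij => by
    have hker : LinearMap.ker (LinearMap.proj (R := ℝ) (φ := fun _ : Fin n => ℝ) i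
        - LinearMap.proj j) ≠ ⊤ := fun htop => by
      have := LinearMap.congr_fun (LinearMap.ker_eq_top.1 htop) (Pi.single i 1)
      simp [hij] at this
    have h0 := Measure.addHaar_submodule (volume : Measure (Fin n → ℝ)) _ hker
    rw [ae_iff]
    refine measure_mono_null (fun t ht => ?_) h0
    simpa [sub_eq_zero] using ht
  have h' : ∀ᵐ t : Fin n → ℝ, ∀ i j : Fin n, i ≠ j → t i ≠ t j :=
    ae_all_iff.2 fun i => ae_all_iff.2 fun j => ae_all_iff.2 fun hij => h i j hij
  filter_upwards [h'] with t ht i j hij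
  by_contra hne
  exact ht i j hne hij

instance isProbabilityMeasure_volume_restrict_Icc :
    IsProbabilityMeasure ((volume : Measure ℝ).restrict (Set.Icc 0 1)) :=
  ⟨by simp⟩

lemma le_integral_prefixReceived (n : ℕ) {f : ℝ → ℝ} (hf : Antitone f) {X : ℕ → ℝ}
    (hX : Antitone X) (hX0 : ∀ j, 0 ≤ X j) {A : ℕ → ℝ}
    (hA : ∀ m, ((volume : Measure ℝ).restrict (Set.Icc 0 1)).real {τ | f τ ≤ X m} = A m) {m : ℕ}
    (hm : m ≤ n) :
    X 0 * A 0 - ∑ j ∈ Finset.range m, A (j + 1) ^ (j + 2) / ((j + 2 : ℕ) : ℝ)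
      * ((∑ i ∈ Finset.range (j + 1), X i) / ((j + 1 : ℕ) : ℝ) - X (j + 1))
    ≤ ∫ t, prefixReceived f X (fun k => t (truncIdx n k)) (m + 1)
      ∂(Measure.pi fun _ : Fin (n + 1) => (volume : Measure ℝ).restrict (Set.Icc 0 1)) := by
  set μ := (volume : Measure ℝ).restrict (Set.Icc 0 1) with hμ
  set ν := Measure.pi fun _ : Fin (n + 1) => μ with hν
  have hB : ∀ m, MeasurableSet {τ | f τ ≤ X m} := fun m =>
    measurableSet_le hf.measurable measurable_const
  have hintegral : ∀ m, Integrable (fun t : Fin (n + 1) → ℝ =>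
      prefixReceived f X (fun k => t (truncIdx n k)) m) ν := fun m =>
    Integrable.of_bound (measurable_prefixReceived n hf.measurable X m).aestronglyMeasurable (X 0)
      (Filter.Eventually.of_forall fun t => abs_prefixReceived_le hX hX0 _ _)
  induction m with
  | zero =>
    have he : (fun t : Fin (n + 1) → ℝ => prefixReceived f X (fun k => t (truncIdx n k)) (0 + 1))
        = {t : Fin (n + 1) → ℝ | ∀ i ∈ ({0} : Finset (Fin (n + 1))),
            t i ∈ {τ | f τ ≤ X 0}}.indicator fun _ => X 0 := by
      funext t
      simp [prefixReceived, Set.indicator_apply, truncIdx]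
    rw [he, integral_indicator_const _ (measurableSet_forall_mem _ (hB 0)),
      pi_real_forall_mem, hA]
    simp [mul_comm]
  | succ m ih =>
    refine le_trans ?_ (integral_mono_ae (((hintegral (m + 1)).sub (integrable_finsetSum
      (Finset.range (m + 1)) fun j _ => (integrable_const (X j - X (m + 1))).indicator
        (measurableSet_firstTwo (Finset.Iic (truncIdx n (m + 1))) (hB (m + 1))
          (truncIdx n (m + 1)) (truncIdx n j))))) (hintegral (m + 1 + 1)) ?_)
    · rw [integral_sub' (hintegral (m + 1)) (integrable_finsetSum _ fun j _ =>
          (integrable_const (X j - X (m + 1))).indicator (measurableSet_firstTwo _ (hB (m + 1)) _ _)),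
        integral_finsetSum _ fun j _ =>
          (integrable_const (X j - X (m + 1))).indicator (measurableSet_firstTwo _ (hB (m + 1)) _ _),
        Finset.sum_range_succ, ← sub_sub]
      refine sub_le_sub (ih (by omega)) ?_
      have hcard : (Finset.Iic (truncIdx n (m + 1))).card = m + 2 := by
        rw [Fin.card_Iic]
        simp only [truncIdx]
        omega
      have hterm : ∀ j ∈ Finset.range (m + 1),
          ∫ t, (firstTwo (Finset.Iic (truncIdx n (m + 1))) {τ | f τ ≤ X (m + 1)}
            (truncIdx n (m + 1)) (truncIdx n j)).indicator (fun _ => X j - X (m + 1)) t ∂ν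
          ≤ A (m + 1) ^ (m + 2) / ((m + 2 : ℕ) : ℝ) / ((m + 1 : ℕ) : ℝ)
            * (X j - X (m + 1)) := fun j hj => by
        rw [Finset.mem_range] at hj
        rw [integral_indicator_const _ (measurableSet_firstTwo _ (hB (m + 1)) _ _), smul_eq_mul]
        refine mul_le_mul_of_nonneg_right ?_ (sub_nonneg.2 (hX hj.le))
        have h := card_mul_pi_real_firstTwo_le μ (hB (m + 1))
          (S := Finset.Iic (truncIdx n (m + 1))) (p := truncIdx n (m + 1)) (q := truncIdx n j)
          (Finset.mem_Iic.2 le_rfl) (Finset.mem_Iic.2 (truncIdx_mono n hj.le)) fun he => by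
            have := congrArg Fin.val he
            simp only [truncIdx] at this
            omega
        rw [hcard, hA] at h
        rw [div_div, le_div_iff₀ (by positivity)]
        push_cast at h ⊢
        refine le_trans (le_of_eq ?_) h
        ring
      refine (Finset.sum_le_sum hterm).trans (le_of_eq ?_)
      rw [← Finset.mul_sum, Finset.sum_sub_distrib, Finset.sum_const, Finset.card_range,
        nsmul_eq_mul]
      have : ((m + 1 : ℕ) : ℝ) ≠ 0 := by positivity
      field_simp
    · filter_upwards [ae_injective_pi_restrict (n + 1)] with t ht
      simpa only [Pi.sub_apply, Finset.sum_apply] using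
        prefixReceived_sub_le hf hX ht (show 1 ≤ m + 1 by omega) hm

lemma real_setOf_exp_le {c y : ℝ} (hc : 0 < c) (hy0 : 0 < y) (hy1 : y ≤ 1) :
    ((volume : Measure ℝ).restrict (Set.Icc 0 1)).real {τ | Real.exp (-τ / c) ≤ y}
      = max 0 (1 + c * Real.log y) := by
  have hlog : Real.log y ≤ 0 := Real.log_nonpos hy0.le hy1
  have h0 : 0 ≤ -(c * Real.log y) := by nlinarith
  have : {τ | Real.exp (-τ / c) ≤ y} ∩ Set.Icc 0 1 = Set.Icc (-(c * Real.log y)) 1 := by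
    ext τ
    simp only [Set.mem_inter_iff, Set.mem_ofPred_eq, Set.mem_Icc]
    rw [← Real.le_log_iff_exp_le hy0, div_le_iff₀ hc]
    constructor
    · rintro ⟨h1, h2, h3⟩
      exact ⟨by linarith, h3⟩
    · rintro ⟨h1, h2⟩
      exact ⟨by linarith, by linarith, h2⟩
  rw [measureReal_restrict_apply' measurableSet_Icc, this, measureReal_def, Real.volume_Icc,
    ENNReal.toReal_ofReal', max_comm, sub_neg_eq_add]

/-- For every instance with pairwise distinct values `1 ≥ x_1 > x_2 > … > x_n ≥ 0`
(with `n ≥ 1` values), the best-only pricing curve with threshold `f(t) = exp(-t/0.611)`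
has regret at most `0.23`. -/
theorem bestOnly_exp_0611_regret_le (n : ℕ) (x : Fin (n + 1) → ℝ)
    (hanti : StrictAnti x) (hx1 : x 0 ≤ 1) (hx0 : 0 ≤ x (Fin.last n)) :
    bestOnlyRegret (fun t => Real.exp (-t / 0.611)) x ≤ 0.23 := by
  set f : ℝ → ℝ := fun t => Real.exp (-t / 0.611) with hf
  set X : ℕ → ℝ := fun k => x (truncIdx n k) with hXdef
  have hX : Antitone X := hanti.antitone.comp_monotone (truncIdx_mono n)
  have hXnn : ∀ j, 0 ≤ X j := fun j => hx0.trans (hanti.antitone (Fin.le_last _))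
  have hX0 : X 0 = x 0 := congrArg x (truncIdx_val (0 : Fin (n + 1)))
  have hX1 : ∀ j, X j ≤ 1 := fun j => (hX (Nat.zero_le j)).trans (hX0.le.trans hx1)
  have hfanti : Antitone f := fun a b hab => Real.exp_le_exp.2 (by gcongr)
  set A : ℕ → ℝ := fun m =>
    ((volume : Measure ℝ).restrict (Set.Icc 0 1)).real {τ | f τ ≤ X m} with hA
  have hApos : ∀ j, 0 < X j → A j = max 0 (1 + 0.611 * Real.log (X j)) := fun j hj =>
    real_setOf_exp_le (by norm_num) hj (hX1 j)
  have hA' : ∀ j, 0 < A j → 0 < X j ∧ A j ≤ 1 + 0.611 * Real.log (X j) := fun j hj => by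
    have hXj : 0 < X j := by
      by_contra! hle
      have : {τ | f τ ≤ X j} = ∅ :=
        Set.eq_empty_of_forall_notMem fun τ hτ => ((Real.exp_pos _).trans_le hτ).not_ge hle
      simp [hA, this] at hj
    refine ⟨hXj, ?_⟩
    rw [hApos j hXj] at hj ⊢
    rcases lt_max_iff.1 hj with h | h
    · exact absurd h (lt_irrefl _)
    · exact (max_eq_right h.le).le
  have hbound := regret_bound hX (hX1 0) (fun j => measureReal_nonneg) hA'
    (fun h => (le_max_right _ _).trans (hApos 0 h).ge) n
  have hlow := le_integral_prefixReceived n hfanti hX hXnn (A := A) (fun _ => rfl) le_rfl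
  have hintegral : ∫ t in Set.univ.pi (fun _ : Fin (n + 1) => Set.Icc (0 : ℝ) 1),
        bestOnlyReceived f x t
      = ∫ t, prefixReceived f X (fun k => t (truncIdx n k)) (n + 1)
        ∂(Measure.pi fun _ : Fin (n + 1) => (volume : Measure ℝ).restrict (Set.Icc 0 1)) := by
    rw [volume_pi, Measure.restrict_pi_pi]
    refine integral_congr_ae ?_
    filter_upwards [ae_injective_pi_restrict (n + 1)] with t ht
    exact bestOnlyReceived_eq f hanti ht
  unfold bestOnlyRegret
  rw [hintegral, ← hX0]
  linarith
end

section
/- For every integer n ≥ 1 and every instance with pairwise distinct values 1 ≥ x_1 > x_2 > … > x_n ≥ 0, the best-only pricing curve with threshold function f(t) = exp(−t/0.472) has regret at most 0.190. -/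
open MeasureTheory

/-- The probability that an item of value `x` arrives at a time `r ∈ [0, 1]` with
`exp (-r / 0.472) ≤ x`. -/
noncomputable def acceptProb (x : ℝ) : ℝ :=
  if 0 < x then max 0 (1 + 0.472 * Real.log x) else 0

/-- Entries `(k, hi, lo)` with `lo / 10 ^ 8 ≤ 1 + 0.472 * log (k / 500) ≤ hi / 10 ^ 8`. -/
def logTable : List (ℕ × ℕ × ℕ) :=
  [(500, 100000000, 100000000), (499, 99905506, 99905505), (498, 99810822, 99810820),
   (497, 99715948, 99715945), (496, 99620883, 99620879), (495, 99525626, 99525621),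
   (494, 99430177, 99430170), (493, 99334534, 99334526), (492, 99238697, 99238688),
   (491, 99142665, 99142655), (490, 99046437, 99046426), (489, 98950013, 98950000),
   (488, 98853391, 98853377), (487, 98756571, 98756556), (486, 98659552, 98659536),
   (485, 98562333, 98562316), (484, 98464913, 98464895), (483, 98367292, 98367273),
   (482, 98269469, 98269449), (481, 98171443, 98171421), (480, 98073212, 98073189),
   (479, 97974777, 97974753), (478, 97876136, 97876111), (477, 97777288, 97777262),
   (476, 97678233, 97678206), (475, 97578970, 97578941), (474, 97479497, 97479467),
   (473, 97379814, 97379783), (472, 97279920, 97279888), (471, 97179814, 97179781),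
   (470, 97079496, 97079462), (469, 96978964, 96978929), (468, 96878217, 96878181),
   (467, 96777255, 96777218), (466, 96676077, 96676038), (465, 96574681, 96574641),
   (464, 96473067, 96473026), (463, 96371234, 96371192), (462, 96269180, 96269137),
   (461, 96166905, 96166861), (460, 96064408, 96064363), (459, 95961688, 95961642),
   (458, 95858744, 95858697), (457, 95755575, 95755527), (456, 95652180, 95652131),
   (455, 95548558, 95548508), (454, 95444708, 95444657), (453, 95340629, 95340577),
   (452, 95236320, 95236267), (451, 95131780, 95131726), (450, 95027008, 95026953),
   (449, 94922003, 94921947), (448, 94816764, 94816707), (447, 94711290, 94711232),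
   (446, 94605579, 94605520), (445, 94499631, 94499571), (444, 94393445, 94393384),
   (443, 94287019, 94286957), (442, 94180353, 94180290), (441, 94073445, 94073381),
   (440, 93966295, 93966229), (439, 93858901, 93858834), (438, 93751262, 93751194),
   (437, 93643377, 93643308), (436, 93535245, 93535174), (435, 93426864, 93426792),
   (434, 93318234, 93318161), (433, 93209353, 93209279), (432, 93100221, 93100145),
   (431, 92990836, 92990758), (430, 92881197, 92881117), (429, 92771302, 92771221),
   (428, 92661151, 92661069), (427, 92550742, 92550659), (426, 92440074, 92439990),
   (425, 92329146, 92329061), (424, 92217957, 92217871), (423, 92106505, 92106418),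
   (422, 91994790, 91994701), (421, 91882809, 91882719), (420, 91770562, 91770471),
   (419, 91658048, 91657955), (418, 91545265, 91545171), (417, 91432212, 91432116),
   (416, 91318887, 91318790), (415, 91205289, 91205191), (414, 91091417, 91091318),
   (413, 90977270, 90977170), (412, 90862846, 90862745), (411, 90748144, 90748042),
   (410, 90633163, 90633060), (409, 90517901, 90517797), (408, 90402357, 90402252),
   (407, 90286529, 90286423), (406, 90170416, 90170309), (405, 90054017, 90053909),
   (404, 89937330, 89937221), (403, 89820354, 89820244), (402, 89703087, 89702976),
   (401, 89585528, 89585416), (400, 89467676, 89467563), (399, 89349529, 89349415),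
   (398, 89231085, 89230970), (397, 89112343, 89112227), (396, 88993302, 88993185),
   (395, 88873960, 88873842), (394, 88754315, 88754196), (393, 88634366, 88634246),
   (392, 88514112, 88513991), (391, 88393551, 88393428), (390, 88272681, 88272557),
   (389, 88151500, 88151375), (388, 88030008, 88029881), (387, 87908202, 87908074),
   (386, 87786081, 87785952), (385, 87663643, 87663513), (384, 87540887, 87540755),
   (383, 87417811, 87417677), (382, 87294413, 87294278), (381, 87170691, 87170555),
   (380, 87046644, 87046507), (379, 86922270, 86922132), (378, 86797568, 86797429),
   (377, 86672535, 86672395), (376, 86547170, 86547029), (375, 86421471, 86421329),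
   (374, 86295437, 86295294), (373, 86169065, 86168921), (372, 86042354, 86042209),
   (371, 85915302, 85915156), (370, 85787907, 85787760), (369, 85660167, 85660019),
   (368, 85532081, 85531931), (367, 85403646, 85403495), (366, 85274861, 85274708),
   (365, 85145723, 85145569), (364, 85016231, 85016076), (363, 84886383, 84886227),
   (362, 84756177, 84756019), (361, 84625610, 84625451), (360, 84494681, 84494521),
   (359, 84363388, 84363227), (358, 84231729, 84231567), (357, 84099702, 84099538),
   (356, 83967304, 83967139), (355, 83834534, 83834367), (354, 83701389, 83701221),
   (353, 83567868, 83567698), (352, 83433968, 83433797), (351, 83299687, 83299515),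
   (350, 83165023, 83164849), (349, 83029973, 83029798), (348, 82894536, 82894360),
   (347, 82758709, 82758532), (346, 82622490, 82622312), (345, 82485877, 82485698),
   (344, 82348867, 82348687), (343, 82211458, 82211277), (342, 82073648, 82073466),
   (341, 81935435, 81935251), (340, 81796816, 81796631), (339, 81657789, 81657602),
   (338, 81518351, 81518162), (337, 81378500, 81378309), (336, 81238233, 81238041),
   (335, 81097548, 81097355), (334, 80956442, 80956248), (333, 80814913, 80814718),
   (332, 80672959, 80672762), (331, 80530576, 80530378), (330, 80387763, 80387563),
   (329, 80244516, 80244315), (328, 80100833, 80100631), (327, 79956711, 79956508),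
   (326, 79812148, 79811944), (325, 79667141, 79666935), (324, 79521687, 79521480),
   (323, 79375783, 79375575), (322, 79229427, 79229218), (321, 79082616, 79082405),
   (320, 78935347, 78935134), (319, 78787617, 78787402), (318, 78639423, 78639206),
   (317, 78490762, 78490544), (316, 78341631, 78341412), (315, 78192028, 78191807),
   (314, 78041949, 78041727), (313, 77891391, 77891168), (312, 77740351, 77740127),
   (311, 77588827, 77588601), (310, 77436815, 77436587), (309, 77284311, 77284082),
   (308, 77131313, 77131083), (307, 76977818, 76977586), (306, 76823822, 76823588),
   (305, 76669322, 76669086), (304, 76514314, 76514077), (303, 76358796, 76358557),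
   (302, 76202763, 76202523), (301, 76046213, 76045971), (300, 75889142, 75888899),
   (299, 75731547, 75731302), (298, 75573424, 75573177), (297, 75414769, 75414521),
   (296, 75255579, 75255329), (295, 75095850, 75095599), (294, 74935579, 74935326),
   (293, 74774762, 74774507), (292, 74613395, 74613139), (291, 74451474, 74451217),
   (290, 74288996, 74288738), (289, 74125957, 74125697), (288, 73962353, 73962091),
   (287, 73798180, 73797916), (286, 73633434, 73633168), (285, 73468111, 73467843),
   (284, 73302206, 73301937), (283, 73135716, 73135446), (282, 72968637, 72968365),
   (281, 72800964, 72800691), (280, 72632694, 72632419), (279, 72463822, 72463545),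
   (278, 72294343, 72294065), (277, 72124253, 72123974), (276, 71953548, 71953268),
   (275, 71782224, 71781942), (274, 71610276, 71609992), (273, 71437699, 71437413),
   (272, 71264488, 71264201), (271, 71090640, 71090351), (270, 70916149, 70915858),
   (269, 70741010, 70740718), (268, 70565219, 70564925), (267, 70388771, 70388475),
   (266, 70211661, 70211363), (265, 70033884, 70033584), (264, 69855435, 69855133),
   (263, 69676308, 69676005), (262, 69496499, 69496194), (261, 69316002, 69315696),
   (260, 69134812, 69134505), (259, 68952924, 68952616), (258, 68770333, 68770023),
   (257, 68587033, 68586721), (256, 68403018, 68402704), (255, 68218283, 68217967),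
   (254, 68032822, 68032504), (253, 67846629, 67846309), (252, 67659699, 67659377),
   (251, 67472026, 67471702), (250, 67283603, 67283278), (249, 67094425, 67094098),
   (248, 66904486, 66904157), (247, 66713779, 66713449), (246, 66522299, 66521967),
   (245, 66330039, 66329705), (244, 66136992, 66136657), (243, 65943153, 65942816),
   (242, 65748514, 65748175), (241, 65553069, 65552729), (240, 65356812, 65356470),
   (239, 65159735, 65159391), (238, 64961832, 64961486), (237, 64763096, 64762748),
   (236, 64563519, 64563169), (235, 64363095, 64362743), (234, 64161816, 64161462),
   (233, 63959675, 63959319), (232, 63756665, 63756307), (231, 63552778, 63552418),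
   (230, 63348006, 63347644), (229, 63142342, 63141978), (228, 62935778, 62935412),
   (227, 62728306, 62727938), (226, 62519918, 62519548), (225, 62310606, 62310234),
   (224, 62100362, 62099987), (223, 61889177, 61888800), (222, 61677043, 61676664),
   (221, 61463951, 61463570), (220, 61249893, 61249509), (219, 61034859, 61034473),
   (218, 60818841, 60818453), (217, 60601830, 60601440), (216, 60383817, 60383424),
   (215, 60164792, 60164397), (214, 59944746, 59944349), (213, 59723669, 59723270),
   (212, 59501552, 59501151), (211, 59278385, 59277981), (210, 59054157, 59053751),
   (209, 58828859, 58828451), (208, 58602481, 58602070), (207, 58375012, 58374598),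
   (206, 58146441, 58146025), (205, 57916758, 57916339), (204, 57685952, 57685530),
   (203, 57454011, 57453587), (202, 57220925, 57220499), (201, 56986682, 56986254),
   (200, 56751271, 56750841), (199, 56514680, 56514248), (198, 56276897, 56276463),
   (197, 56037910, 56037474), (196, 55797707, 55797268), (195, 55556275, 55555834),
   (194, 55313602, 55313158), (193, 55069675, 55069228), (192, 54824481, 54824031),
   (191, 54578006, 54577554), (190, 54330237, 54329783), (189, 54081161, 54080704),
   (188, 53830764, 53830304), (187, 53579031, 53578568), (186, 53325948, 53325483),
   (185, 53071501, 53071033), (184, 52815675, 52815204), (183, 52558455, 52557981),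
   (182, 52299825, 52299348), (181, 52039770, 52039290), (180, 51778275, 51777792),
   (179, 51515323, 51514837), (178, 51250898, 51250409), (177, 50984983, 50984491),
   (176, 50717561, 50717066), (175, 50448616, 50448117), (174, 50178129, 50177627),
   (173, 49906083, 49905578), (172, 49632460, 49631952), (171, 49357242, 49356731),
   (170, 49080410, 49079895), (169, 48801944, 48801426), (168, 48521826, 48521304),
   (167, 48240035, 48239510), (166, 47956552, 47956023), (165, 47671356, 47670824),
   (164, 47384426, 47383891), (163, 47095741, 47095203), (162, 46805280, 46804738),
   (161, 46513020, 46512475), (160, 46218940, 46218391), (159, 45923016, 45922463),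
   (158, 45625225, 45624668), (157, 45325543, 45324982), (156, 45023946, 45023381),
   (155, 44720410, 44719840), (154, 44414909, 44414335), (153, 44107418, 44106839),
   (152, 43797910, 43797327), (151, 43486359, 43485772), (150, 43172738, 43172147),
   (149, 42857019, 42856424), (148, 42539174, 42538575), (147, 42219174, 42218571),
   (146, 41896990, 41896382), (145, 41572592, 41571979), (144, 41245949, 41245331),
   (143, 40917030, 40916407), (142, 40585802, 40585174), (141, 40252234, 40251600),
   (140, 39916291, 39915652), (139, 39577940, 39577296), (138, 39237146, 39236497),
   (137, 38893874, 38893219), (136, 38548087, 38547426), (135, 38199748, 38199081),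
   (134, 37848819, 37848146), (133, 37495261, 37494582), (132, 37139035, 37138350),
   (131, 36780100, 36779409), (130, 36418415, 36417717), (129, 36053937, 36053232),
   (128, 35686622, 35685911), (127, 35316426, 35315709), (126, 34943304, 34942580),
   (125, 34567209, 34566478), (124, 34188093, 34187355), (123, 33805907, 33805162),
   (122, 33420601, 33419849), (121, 33032124, 33031365), (120, 32640423, 32639657),
   (119, 32245444, 32244671), (118, 31847132, 31846351), (117, 31445430, 31444641),
   (116, 31040280, 31039483), (115, 30631622, 30630817), (114, 30219395, 30218582),
   (113, 29803536, 29802714), (112, 29383981, 29383150), (111, 28960663, 28959823),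
   (110, 28533514, 28532664), (109, 28102464, 28101604), (108, 27667441, 27666571),
   (107, 27228372, 27227491), (106, 26785180, 26784288), (105, 26337787, 26336884),
   (104, 25886113, 25885199), (103, 25430075, 25429149), (102, 24969588, 24968650),
   (101, 24504564, 24503614), (100, 24034913, 24033950), (99, 23560542, 23559566),
   (98, 23081355, 23080365), (97, 22597253, 22596249), (96, 22108134, 22107116),
   (95, 21613894, 21612861), (94, 21114424, 21113376), (93, 20609612, 20608548),
   (92, 20099342, 20098262), (91, 19583496, 19582399), (90, 19061950, 19060836),
   (89, 18534576, 18533445), (88, 18001243, 18000094), (87, 17461815, 17460647),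
   (86, 16916151, 16914964), (85, 16364105, 16362898), (84, 15805526, 15804298),
   (83, 15240257, 15239008), (82, 14668136, 14666865), (81, 14088995, 14087702),
   (80, 13502660, 13501343), (79, 12908950, 12907608), (78, 12307677, 12306309),
   (77, 11698645, 11697251), (76, 11081652, 11080231), (75, 10456487, 10455038),
   (74, 9822930, 9821452), (73, 9180754, 9179245), (72, 8529720, 8528179), (71, 7869581, 7868006),
   (70, 7200078, 7198468), (69, 6520942, 6519296), (68, 5831891, 5830208), (67, 5132632, 5130910),
   (66, 4422858, 4421095), (65, 3702248, 3700442), (64, 2970466, 2968615), (63, 2227159, 2225261),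
   (62, 1471959, 1470012), (61, 704480, 702481)]

/-- `potential j i / (10 ^ 4 * 500 ^ 7)` bounds the total increase of the regret caused by the
items from the `j`-th on, when the items before the `j`-th have mean at most `i / 500`.
(Written with the bare operations on `ℕ` for fast evaluation.) -/
def potential (j i : ℕ) : ℕ :=
  match j with
  | 2 => Nat.mul (Nat.pow i 2) (Nat.add (Nat.mul i 105625000000000) 6125000000000000)
  | 3 => Nat.mul (Nat.pow i 2) (Nat.add (Nat.mul (Nat.pow i 2) 187125000000) 1281250000000000)
  | 4 => Nat.mul (Nat.pow i 4) (Nat.add (Nat.mul i 296250000) 29500000000)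
  | 5 => Nat.mul (Nat.pow i 5) (Nat.add (Nat.mul i 380000) 147750000)
  | 6 => Nat.mul (Nat.pow i 5) (Nat.add (Nat.mul i 633000) 4250000)
  | 7 => Nat.mul (Nat.pow i 6) (Nat.add (Nat.mul i 476) 374500)
  | _ => Nat.mul (Nat.pow i 6) (Nat.add (Nat.mul i 705) 232000)

/-- One grid inequality: the `j`-th item, of value at most `k / 500` with acceptance probability
at most `w / 10 ^ 8`, arrives while the mean of its predecessors is at most `i / 500`. -/
def stepOK (j i v k w : ℕ) : Bool :=
  Nat.ble (Nat.add
    (Nat.mul (Nat.mul (Nat.pow w j) (Nat.add (Nat.div (Nat.sub i k) j) 1)) 156250000000000000000)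
    (Nat.mul (potential (Nat.add j 1) (Nat.sub i (Nat.div (Nat.sub i k) j)))
      (Nat.pow 100000000 j))) v

/-- All grid inequalities for a given `i`, with `k` running through the list `l`. -/
noncomputable def stepRow (j i v : ℕ) (l : List (ℕ × ℕ × ℕ)) : Bool :=
  List.rec true (fun p _ ih => cond (Nat.beq (Nat.mod (Nat.sub i p.1) j) 0)
    (cond (stepOK j i v p.1 p.2.1) ih false) ih) l

/-- All grid inequalities, with `i` running through the list `l` and `k` after `i` in it. -/
noncomputable def stepCheck (j : ℕ) (l : List (ℕ × ℕ × ℕ)) : Bool :=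
  List.rec true (fun p l ih =>
    cond (stepRow j p.1 (Nat.mul (potential j p.1) (Nat.pow 100000000 j)) (p :: l)) ih false) l

theorem stepRow_cons (j i v : ℕ) (a : ℕ × ℕ × ℕ) (l : List (ℕ × ℕ × ℕ)) :
    stepRow j i v (a :: l) = cond (Nat.beq (Nat.mod (Nat.sub i a.1) j) 0)
      (cond (stepOK j i v a.1 a.2.1) (stepRow j i v l) false) (stepRow j i v l) := rfl

theorem stepCheck_cons (j : ℕ) (a : ℕ × ℕ × ℕ) (l : List (ℕ × ℕ × ℕ)) :
    stepCheck j (a :: l) =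
      cond (stepRow j a.1 (Nat.mul (potential j a.1) (Nat.pow 100000000 j)) (a :: l))
        (stepCheck j l) false := rfl

theorem stepRow_imp {j i v : ℕ} {l : List (ℕ × ℕ × ℕ)} (h : stepRow j i v l = true) :
    ∀ p ∈ l, Nat.mod (Nat.sub i p.1) j = 0 → stepOK j i v p.1 p.2.1 = true := by
  induction l with
  | nil => simp
  | cons a l ih =>
    rw [stepRow_cons] at h
    intro p hp hm
    generalize hs : stepOK j i v a.1 a.2.1 = s at h
    generalize hb : Nat.beq (Nat.mod (Nat.sub i a.1) j) 0 = b at h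
    rcases List.mem_cons.1 hp with rfl | hp
    · rw [hm] at hb
      rw [hs]
      subst hb
      cases s
      · exact h
      · rfl
    · refine ih ?_ p hp hm
      cases b
      · exact h
      · cases s
        · exact absurd h Bool.false_ne_true
        · exact h

theorem stepCheck_imp {j : ℕ} {l : List (ℕ × ℕ × ℕ)} (h : stepCheck j l = true)
    (hl : l.Pairwise fun p q => q.1 < p.1) :
    ∀ p ∈ l, ∀ q ∈ l, q.1 ≤ p.1 → Nat.mod (Nat.sub p.1 q.1) j = 0 →
      stepOK j p.1 (Nat.mul (potential j p.1) (Nat.pow 100000000 j)) q.1 q.2.1 = true := by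
  induction l with
  | nil => simp
  | cons a l ih =>
    rw [stepCheck_cons] at h
    generalize hr : stepRow j a.1 (Nat.mul (potential j a.1) (Nat.pow 100000000 j)) (a :: l) = r
      at h
    cases r
    · exact absurd h Bool.false_ne_true
    rw [List.pairwise_cons] at hl
    intro p hp q hq hpq hm
    rcases List.mem_cons.1 hp with hpa | hp
    · subst hpa
      exact stepRow_imp hr q hq hm
    · rcases List.mem_cons.1 hq with hqa | hq
      · rw [hqa] at hpq
        exact absurd hpq (not_le.2 (hl.1 p hp))
      · exact ih h hl.2 p hp q hq hpq hm

theorem logTable_isChain : logTable.IsChain fun p q => p.1 = q.1 + 1 ∧ 61 ≤ q.1 ∧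
    p.2.1 * ((2 * q.1 + 1) * 1000) ≤ q.2.1 * ((2 * q.1 + 1) * 1000) + 944 * 10 ^ 8 ∧
    q.2.2 * (2000 * q.1 * (q.1 + 1)) + 472 * 10 ^ 8 * (2 * q.1 + 1) ≤
      p.2.2 * (2000 * q.1 * (q.1 + 1)) := by
  decide +kernel

theorem logTable_pairwise : logTable.Pairwise fun p q => q.1 < p.1 := by
  have h : logTable.IsChain fun p q => q.1 < p.1 :=
    logTable_isChain.imp fun p q h => by omega
  have : IsTrans (ℕ × ℕ × ℕ) fun p q => q.1 < p.1 := ⟨fun a b c h1 h2 => h2.trans h1⟩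
  exact List.isChain_iff_pairwise.1 h

theorem exists_mem_logTable {k : ℕ} (h1 : 61 ≤ k) (h2 : k ≤ 500) :
    ∃ p ∈ logTable, p.1 = k := by
  have h : logTable.map Prod.fst = (List.range' 61 440).reverse := by decide +kernel
  have hk : k ∈ logTable.map Prod.fst := by
    rw [h, List.mem_reverse, List.mem_range'_1]
    omega
  simpa using hk

theorem logTable_mem_bounds : ∀ p ∈ logTable, 61 ≤ p.1 ∧ p.1 ≤ 500 := by
  decide +kernel

/-- Bounds on `log ((k + 1) / k)` by the midpoint and trapezoidal rules. -/
theorem log_succ_div_bounds {k : ℝ} (hk : 0 < k) :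
    2 / (2 * k + 1) ≤ Real.log ((k + 1) / k) ∧
      Real.log ((k + 1) / k) ≤ (2 * k + 1) / (2 * k * (k + 1)) := by
  constructor
  · have h := Real.le_log_one_add_of_nonneg (x := 1 / k) (by positivity)
    convert h using 1
    · field_simp
      ring
    · congr 1
      field_simp
  · have hlog : 0 ≤ Real.log ((k + 1) / k) :=
      Real.log_nonneg ((one_le_div hk).2 (by linarith))
    refine (Real.self_le_sinh_iff.2 hlog).trans_eq ?_
    rw [Real.sinh_log (by positivity)]
    field_simp
    ring

theorem logTable_spec : ∀ p ∈ logTable,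
    (p.2.2 : ℝ) / 10 ^ 8 ≤ 1 + 0.472 * Real.log ((p.1 : ℝ) / 500) ∧
      1 + 0.472 * Real.log ((p.1 : ℝ) / 500) ≤ (p.2.1 : ℝ) / 10 ^ 8 := by
  refine List.IsChain.induction _ _ logTable_isChain ?_ ?_
  · rintro ⟨k', w', l'⟩ ⟨k, w, l⟩ ⟨h1, h2, h3, h4⟩ ⟨h5, h6⟩
    dsimp only at *
    subst h1
    have hk : (0 : ℝ) < k := by
      have : (61 : ℝ) ≤ k := by exact_mod_cast h2
      linarith
    have hlog : Real.log ((k + 1 : ℕ) / 500 : ℝ) =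
        Real.log ((k : ℝ) / 500) + Real.log (((k : ℝ) + 1) / k) := by
      rw [← Real.log_mul (by positivity) (by positivity)]
      congr 1
      push_cast
      field_simp
    rw [hlog] at h5 h6
    obtain ⟨b1, b2⟩ := log_succ_div_bounds hk
    have h3' : (w' : ℝ) * ((2 * k + 1) * 1000) ≤ w * ((2 * k + 1) * 1000) + 944 * 10 ^ 8 := by
      exact_mod_cast h3
    have h4' : (l : ℝ) * (2000 * k * (k + 1)) + 472 * 10 ^ 8 * (2 * k + 1) ≤
        l' * (2000 * k * (k + 1)) := by exact_mod_cast h4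
    constructor
    · have : (l : ℝ) / 10 ^ 8 + 0.472 * ((2 * k + 1) / (2 * k * (k + 1))) ≤ l' / 10 ^ 8 := by
        have e : (l' : ℝ) / 10 ^ 8 - (l / 10 ^ 8 + 0.472 * ((2 * k + 1) / (2 * k * (k + 1)))) =
          (l' * (2000 * k * (k + 1)) - (l * (2000 * k * (k + 1)) + 472 * 10 ^ 8 * (2 * k + 1))) /
            (10 ^ 8 * (2000 * k * (k + 1))) := by
          field_simp
          ring
        have : 0 ≤ (l' : ℝ) / 10 ^ 8 -
            (l / 10 ^ 8 + 0.472 * ((2 * k + 1) / (2 * k * (k + 1)))) := by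
          rw [e]
          apply div_nonneg (by linarith) (by positivity)
        linarith
      linarith
    · have : (w' : ℝ) / 10 ^ 8 ≤ w / 10 ^ 8 + 0.472 * (2 / (2 * k + 1)) := by
        have e : (w : ℝ) / 10 ^ 8 + 0.472 * (2 / (2 * k + 1)) - w' / 10 ^ 8 =
          (w * ((2 * k + 1) * 1000) + 944 * 10 ^ 8 - w' * ((2 * k + 1) * 1000)) /
            (10 ^ 8 * ((2 * k + 1) * 1000)) := by
          field_simp
          ring
        have : 0 ≤ (w : ℝ) / 10 ^ 8 + 0.472 * (2 / (2 * k + 1)) - w' / 10 ^ 8 := by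
          rw [e]
          apply div_nonneg (by linarith) (by positivity)
        linarith
      linarith
  · intro _
    have h : logTable.head? = some (500, 100000000, 100000000) := rfl
    rw [List.head_of_head?_eq_some h]
    norm_num

theorem stepCheck_logTable : stepCheck 2 logTable = true ∧ stepCheck 3 logTable = true ∧
    stepCheck 4 logTable = true ∧ stepCheck 5 logTable = true ∧ stepCheck 6 logTable = true ∧
    stepCheck 7 logTable = true := by
  refine ⟨?_, ?_, ?_, ?_, ?_, ?_⟩ <;> decide +kernel

theorem potential_eight_check : ∀ p ∈ logTable,
    7 * p.1 * p.2.1 ^ 9 * (10 ^ 4 * 500 ^ 7) ≤ 47200 * potential 8 p.1 * (10 ^ 8) ^ 9 := by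
  decide +kernel

theorem base_check : ∀ p ∈ logTable, p.1 < 500 →
    (52800000 ≤ p.2.2 ∧ p.1 * 10 ^ 8 * (10 ^ 4 * 500 ^ 6) + potential 2 (p.1 + 1) * 10 ^ 8 ≤
      19 * 10 ^ 6 * (10 ^ 4 * 500 ^ 7) + p.1 * p.2.2 * (10 ^ 4 * 500 ^ 6)) ∨
    17365 * (10 ^ 4 * 500 ^ 7) + potential 2 (p.1 + 1) * 10 ^ 5 ≤
      19000 * (10 ^ 4 * 500 ^ 7) := by
  decide +kernel

theorem acceptProb_nonneg (x : ℝ) : 0 ≤ acceptProb x := by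
  unfold acceptProb
  split_ifs
  · exact le_max_left _ _
  · exact le_rfl

theorem acceptProb_le_one {x : ℝ} (hx : x ≤ 1) : acceptProb x ≤ 1 := by
  unfold acceptProb
  split_ifs with h
  · have := Real.log_nonpos h.le hx
    exact max_le zero_le_one (by linarith)
  · exact zero_le_one

theorem acceptProb_mono : Monotone acceptProb := by
  intro x y hxy
  by_cases hx : 0 < x
  · have := Real.log_le_log hx hxy
    simp only [acceptProb, hx, hx.trans_le hxy, if_true]
    exact max_le_max le_rfl (by linarith)
  · rw [acceptProb, if_neg hx]
    exact acceptProb_nonneg y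

theorem le_acceptProb {x : ℝ} (hx : 0 < x) : 1 + 0.472 * Real.log x ≤ acceptProb x := by
  rw [acceptProb, if_pos hx]
  exact le_max_right _ _

theorem acceptProb_eq_of_pos {x : ℝ} (hx : 0 < acceptProb x) :
    0 < x ∧ acceptProb x = 1 + 0.472 * Real.log x := by
  by_cases h : 0 < x
  · refine ⟨h, ?_⟩
    rw [acceptProb, if_pos h] at hx ⊢
    exact max_eq_right ((lt_max_iff.1 hx).resolve_left (lt_irrefl _)).le
  · rw [acceptProb, if_neg h] at hx
    exact absurd hx (lt_irrefl _)

theorem lt_of_acceptProb_pos {x : ℝ} (hx : 0 < acceptProb x) : 60 < 500 * x := by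
  obtain ⟨h0, h⟩ := acceptProb_eq_of_pos hx
  rw [h] at hx
  by_contra hc
  have h1 : Real.log x ≤ Real.log (25 / 3)⁻¹ := Real.log_le_log h0 (by linarith)
  rw [Real.log_inv] at h1
  have h2 : (125 : ℝ) ≤ 59 * Real.log (25 / 3) := by
    have h3 : Real.exp 125 ≤ (25 / 3 : ℝ) ^ 59 := by
      have h4 : Real.exp 125 = Real.exp 1 ^ 125 := by rw [← Real.exp_nat_mul]; norm_num
      rw [h4]
      calc Real.exp 1 ^ 125 ≤ 2.7182818286 ^ 125 := by
            gcongr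
            exact Real.exp_one_lt_d9.le
        _ ≤ _ := by norm_num
    have := (Real.le_log_iff_exp_le (by positivity)).2 h3
    rwa [Real.log_pow] at this
  linarith

theorem acceptProb_le_of_mem {p : ℕ × ℕ × ℕ} (hp : p ∈ logTable) {x : ℝ}
    (hx : x ≤ (p.1 : ℝ) / 500) : acceptProb x ≤ (p.2.1 : ℝ) / 10 ^ 8 := by
  refine (acceptProb_mono hx).trans ?_
  have : (61 : ℝ) ≤ p.1 := by exact_mod_cast (logTable_mem_bounds p hp).1
  rw [acceptProb, if_pos (by positivity)]
  exact max_le (by positivity) (logTable_spec p hp).2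

theorem stepCheck_of_mem {j : ℕ} (h1 : 2 ≤ j) (h2 : j ≤ 7) : stepCheck j logTable = true := by
  obtain ⟨c2, c3, c4, c5, c6, c7⟩ := stepCheck_logTable
  interval_cases j
  exacts [c2, c3, c4, c5, c6, c7]

/-- The grid inequality between consecutive potentials. -/
theorem grid_ineq {j e : ℕ} (h1 : 2 ≤ j) (h2 : j ≤ 7) {p q : ℕ × ℕ × ℕ} (hp : p ∈ logTable)
    (hq : q ∈ logTable) (he : p.1 = q.1 + j * e) :
    ((q.2.1 : ℝ) / 10 ^ 8) ^ j * ((e + 1) / 500) +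
        potential (j + 1) (p.1 - e) / (10 ^ 4 * 500 ^ 7) ≤
      potential j p.1 / (10 ^ 4 * 500 ^ 7) := by
  have hs : Nat.sub p.1 q.1 = j * e := by
    change p.1 - q.1 = _
    omega
  have h := stepCheck_imp (stepCheck_of_mem h1 h2) logTable_pairwise p hp q hq (by omega)
    (by rw [hs]; exact Nat.mul_mod_right j e)
  have hd : Nat.div (j * e) j = e := Nat.mul_div_cancel_left e (by omega)
  rw [stepOK, hs, hd] at h
  have h' : q.2.1 ^ j * (e + 1) * 156250000000000000000 +
      potential (j + 1) (p.1 - e) * 100000000 ^ j ≤ potential j p.1 * 100000000 ^ j :=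
    Nat.le_of_ble_eq_true h
  have h3 : (q.2.1 : ℝ) ^ j * (e + 1) * 156250000000000000000 +
      potential (j + 1) (p.1 - e) * 100000000 ^ j ≤ potential j p.1 * 100000000 ^ j := by
    exact_mod_cast h'
  have hD : (0 : ℝ) < 100000000 ^ j := by positivity
  rw [← sub_nonneg] at h3 ⊢
  have e1 : (potential j p.1 : ℝ) / (10 ^ 4 * 500 ^ 7) - (((q.2.1 : ℝ) / 10 ^ 8) ^ j *
      ((e + 1) / 500) + potential (j + 1) (p.1 - e) / (10 ^ 4 * 500 ^ 7)) =
      (potential j p.1 * 100000000 ^ j - ((q.2.1 : ℝ) ^ j * (e + 1) * 156250000000000000000 +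
      potential (j + 1) (p.1 - e) * 100000000 ^ j)) / (10 ^ 4 * 500 ^ 7 * 100000000 ^ j) := by
    rw [div_pow, show (10 : ℝ) ^ 8 = 100000000 by norm_num]
    field_simp
    ring
  rw [e1]
  exact div_nonneg h3 (by positivity)

theorem grid_step {j i : ℕ} (h1 : 2 ≤ j) (h2 : j ≤ 7) (hi1 : 61 ≤ i) (hi2 : i ≤ 500)
    {x M : ℝ} (hM : M ≤ (i : ℝ) / 500) (hxM : x ≤ M) :
    ∃ i' : ℕ, 61 ≤ i' ∧ i' ≤ 500 ∧ M - (M - x) / j ≤ (i' : ℝ) / 500 ∧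
      acceptProb x ^ j / j * (M - x) + potential (j + 1) i' / (10 ^ 4 * 500 ^ 7) ≤
        potential j i / (10 ^ 4 * 500 ^ 7) := by
  have hj : (0 : ℝ) < j := by
    have : (2 : ℝ) ≤ j := by exact_mod_cast h1
    linarith
  obtain ⟨p, hp, rfl⟩ := exists_mem_logTable hi1 hi2
  rcases (acceptProb_nonneg x).eq_or_lt with h0 | h0
  · refine ⟨p.1, hi1, hi2, ?_, ?_⟩
    · have : 0 ≤ (M - x) / j := div_nonneg (by linarith) hj.le
      linarith
    · rw [← h0, zero_pow (by omega), zero_div, zero_mul, zero_add]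
      have h := grid_ineq (e := 0) h1 h2 hp hp (by simp)
      have : 0 ≤ ((p.2.1 : ℝ) / 10 ^ 8) ^ j * (((0 : ℕ) + 1) / 500) := by positivity
      simp only [Nat.sub_zero] at h
      linarith
  · have hx := lt_of_acceptProb_pos h0
    have hxi : 0 ≤ ((p.1 : ℝ) - 500 * x) / j := div_nonneg (by linarith) hj.le
    obtain ⟨e, he⟩ : ∃ e : ℕ, e = ⌊((p.1 : ℝ) - 500 * x) / j⌋₊ := ⟨_, rfl⟩
    have he1 : (e : ℝ) ≤ ((p.1 : ℝ) - 500 * x) / j := he ▸ Nat.floor_le hxi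
    have he2 : ((p.1 : ℝ) - 500 * x) / j < e + 1 := he ▸ Nat.lt_floor_add_one _
    rw [le_div_iff₀ hj] at he1
    rw [div_lt_iff₀ hj] at he2
    have hlt : 60 + j * e < p.1 := by
      have : (60 : ℝ) + j * e < p.1 := by linarith
      exact_mod_cast this
    obtain ⟨k, hk⟩ : ∃ k, p.1 = k + j * e := ⟨p.1 - j * e, by omega⟩
    have hej : e ≤ j * e := Nat.le_mul_of_pos_left e (by omega)
    obtain ⟨q, hq, rfl⟩ := exists_mem_logTable (k := k) (by omega) (by omega)
    have hkr : (p.1 : ℝ) = q.1 + j * e := by exact_mod_cast hk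
    have h := grid_ineq h1 h2 hp hq hk
    have hu := acceptProb_le_of_mem hq (x := x) (by linarith)
    refine ⟨p.1 - e, by omega, by omega, ?_, ?_⟩
    · rw [Nat.cast_sub (by omega)]
      have : M - (M - x) / j = ((j - 1) * M + x) / j := by
        field_simp
        ring
      rw [this, div_le_iff₀ hj]
      have hj1 : (1 : ℝ) ≤ j := by exact_mod_cast (by omega : 1 ≤ j)
      have := mul_le_mul_of_nonneg_left hM (sub_nonneg.2 hj1)
      linarith
    · have : acceptProb x ^ j / j * (M - x) ≤ ((q.2.1 : ℝ) / 10 ^ 8) ^ j * ((e + 1) / 500) := by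
        rw [div_mul_eq_mul_div, mul_div_assoc]
        have : (M - x) / j ≤ (e + 1) / 500 := by
          rw [div_le_iff₀ hj]
          linarith
        gcongr
      linarith

/-- Bound for the total increase of the regret caused by the items from the `j`-th on, when the
items before the `j`-th have mean `M` and `j` is large. -/
noncomputable def tailPotential (j : ℕ) (M : ℝ) : ℝ :=
  0.28 * (M / 0.472) * acceptProb M ^ (j + 1) / j

theorem tailPotential_eight_le {i : ℕ} (hi1 : 61 ≤ i) (hi2 : i ≤ 500) {M : ℝ}
    (hM : M ≤ (i : ℝ) / 500) :
    tailPotential 8 M ≤ potential 8 i / (10 ^ 4 * 500 ^ 7) := by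
  obtain ⟨p, hp, rfl⟩ := exists_mem_logTable hi1 hi2
  have hu := acceptProb_le_of_mem hp hM
  have h0 := acceptProb_nonneg M
  have h : (7 * p.1 * p.2.1 ^ 9 * (10 ^ 4 * 500 ^ 7) : ℝ) ≤
      47200 * potential 8 p.1 * (10 ^ 8) ^ 9 := by
    exact_mod_cast potential_eight_check p hp
  calc tailPotential 8 M
      ≤ 0.28 * ((p.1 : ℝ) / 500 / 0.472) * ((p.2.1 : ℝ) / 10 ^ 8) ^ (8 + 1) / (8 : ℕ) := by
        unfold tailPotential
        gcongr
    _ = (7 * p.1 * p.2.1 ^ 9 * (10 ^ 4 * 500 ^ 7) : ℝ) /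
          (47200 * (10 ^ 8) ^ 9 * (10 ^ 4 * 500 ^ 7)) := by
        rw [div_pow]
        push_cast
        field_simp
        ring
    _ ≤ _ := by
        rw [div_le_div_iff₀ (by positivity) (by positivity)]
        nlinarith

theorem one_sub_pow_mul_le_one {z : ℝ} (h0 : 0 ≤ z) (h1 : z ≤ 1) (m : ℕ) :
    (1 - z) ^ m * (1 + m * z) ≤ 1 := by
  calc (1 - z) ^ m * (1 + m * z) ≤ (1 - z) ^ m * (1 + z) ^ m := by
        have := one_add_mul_le_pow (a := z) (by linarith) m
        have : 0 ≤ (1 - z) ^ m := pow_nonneg (by linarith) m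
        gcongr
    _ = (1 - z ^ 2) ^ m := by
        rw [← mul_pow]
        ring
    _ ≤ 1 := pow_le_one₀ (by nlinarith) (by nlinarith)

theorem tail_poly {j y : ℝ} (hj : 8 ≤ j) (hy : 0 ≤ y) :
    (j + 1) * y * (j + (j + 2) * y) ≤ 0.28 * (j + (j + 1) * (j + 2) * y) * (1 + j * y) := by
  obtain ⟨s, rfl⟩ : ∃ s, j = 8 + s := ⟨j - 8, by ring⟩
  have hs : 0 ≤ s := by linarith
  nlinarith [mul_nonneg hs (sq_nonneg (1 - (8 + s) * y)), sq_nonneg (1 - 7.5 * y),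
    mul_nonneg hs hy, mul_nonneg (mul_nonneg hs hs) hy, mul_nonneg hs (sq_nonneg y),
    mul_nonneg (mul_nonneg hs hs) (sq_nonneg y),
    mul_nonneg (mul_nonneg (mul_nonneg hs hs) hs) (sq_nonneg y),
    mul_nonneg hs (sq_nonneg (1 - 8 * y)), sq_nonneg (1 - (8 + s) * y)]

theorem tail_bracket {j : ℕ} (hj : 8 ≤ j) {y : ℝ} (hy0 : 0 ≤ y) (hy1 : y ≤ 1) :
    y * (1 - y) ^ j / j + 0.28 * (1 - y / j) ^ (j + 2) / (j + 1) ≤ 0.28 / j := by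
  have hj8 : (8 : ℝ) ≤ j := by exact_mod_cast hj
  have hj0 : (0 : ℝ) < j := by linarith
  have hp := one_sub_pow_mul_le_one hy0 hy1 j
  have hq := one_sub_pow_mul_le_one (z := y / j) (by positivity)
    ((div_le_one hj0).2 (by linarith)) (j + 2)
  push_cast at hq
  have hp' : (1 - y) ^ j ≤ 1 / (1 + j * y) := by
    rwa [le_div_iff₀ (by positivity)]
  have hq' : (1 - y / j) ^ (j + 2) ≤ j / (j + (j + 2) * y) := by
    rw [le_div_iff₀ (by positivity)]
    have : (1 - y / j) ^ (j + 2) * (j + (j + 2) * y) =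
        j * ((1 - y / j) ^ (j + 2) * (1 + (j + 2) * (y / j))) := by
      field_simp
    rw [this]
    nlinarith
  have key := tail_poly hj8 hy0
  calc y * (1 - y) ^ j / j + 0.28 * (1 - y / j) ^ (j + 2) / (j + 1)
      ≤ y * (1 / (1 + j * y)) / j + 0.28 * (j / (j + (j + 2) * y)) / (j + 1) := by gcongr
    _ = 0.28 / j - (0.28 * (j + (j + 1) * (j + 2) * y) * (1 + j * y) -
          (j + 1) * y * (j + (j + 2) * y)) /
          (j * (j + 1) * (1 + j * y) * (j + (j + 2) * y)) := by
        field_simp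
        ring
    _ ≤ _ := by
        rw [sub_le_self_iff]
        exact div_nonneg (by linarith) (by positivity)

theorem tail_step {j : ℕ} (hj : 8 ≤ j) {x M : ℝ} (hx0 : 0 ≤ x) (hxM : x ≤ M) (hM : M ≤ 1) :
    acceptProb x ^ j / j * (M - x) + tailPotential (j + 1) (M - (M - x) / j) ≤
      tailPotential j M := by
  have hj8 : (8 : ℝ) ≤ j := by exact_mod_cast hj
  have hj0 : (0 : ℝ) < j := by linarith
  obtain ⟨M', hM'⟩ : ∃ M', M' = M - (M - x) / j := ⟨_, rfl⟩
  have hd : 0 ≤ (M - x) / j := div_nonneg (by linarith) hj0.le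
  have hd' : (M - x) / j ≤ M - x := div_le_self (by linarith) (by linarith)
  have hM'M : M' ≤ M := by linarith
  have hxM' : x ≤ M' := by linarith
  rw [← hM']
  unfold tailPotential
  have hu0 := acceptProb_nonneg x
  have hu0' := acceptProb_nonneg M'
  have hux := acceptProb_mono hxM
  have huM := acceptProb_mono hM'M
  have hU1 := acceptProb_le_one hM
  rcases hu0.eq_or_lt with h0 | h0
  · rw [← h0, zero_pow (by omega), zero_div, zero_mul, zero_add]
    have hpow : acceptProb M' ^ (j + 1 + 1) ≤ acceptProb M ^ (j + 1) :=
      (pow_le_pow_of_le_one hu0' (huM.trans hU1) (Nat.le_succ _)).trans (by gcongr)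
    have hM0 : 0 ≤ M := hx0.trans hxM
    have hU0 := acceptProb_nonneg M
    have hj1 : (j : ℝ) ≤ (j + 1 : ℕ) := by
      push_cast
      linarith
    gcongr
  · obtain ⟨hx, hux'⟩ := acceptProb_eq_of_pos h0
    have hU := h0.trans_le hux
    obtain ⟨hMp, hU'⟩ := acceptProb_eq_of_pos hU
    obtain ⟨-, huM'⟩ := acceptProb_eq_of_pos (h0.trans_le (acceptProb_mono hxM'))
    generalize acceptProb M = U at *
    obtain ⟨y, hy⟩ : ∃ y, y = 0.472 * (M - x) / (M * U) := ⟨_, rfl⟩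
    have hy0 : 0 ≤ y := by
      rw [hy]
      exact div_nonneg (by linarith) (by positivity)
    have tangent : ∀ z, 0 < z → 1 + 0.472 * Real.log z ≤ U - 0.472 * (M - z) / M := by
      intro z hz
      have h := Real.log_le_sub_one_of_pos (div_pos hz hMp)
      rw [Real.log_div hz.ne' hMp.ne'] at h
      have : 0.472 * (M - z) / M = 0.472 * (1 - z / M) := by field_simp
      rw [this]
      linarith
    have hxU : acceptProb x ≤ U * (1 - y) := by
      rw [hux']
      refine (tangent x hx).trans_eq ?_
      rw [hy]
      field_simp
    have hMU : acceptProb M' ≤ U * (1 - y / j) := by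
      rw [huM']
      refine (tangent M' (hx.trans_le hxM')).trans_eq ?_
      rw [hy, hM']
      field_simp
      ring
    have hy1 : 0 ≤ 1 - y := (pos_of_mul_pos_right (h0.trans_le hxU) hU.le).le
    have hyj : 0 ≤ 1 - y / j := (pos_of_mul_pos_right
      ((h0.trans_le (acceptProb_mono hxM')).trans_le hMU) hU.le).le
    have hMx : M - x = y * U * M / 0.472 := by
      rw [hy]
      field_simp
    have hb := tail_bracket hj hy0 (by linarith)
    calc acceptProb x ^ j / j * (M - x) +
          0.28 * (M' / 0.472) * acceptProb M' ^ (j + 1 + 1) / ((j + 1 : ℕ) : ℝ)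
        ≤ (U * (1 - y)) ^ j / j * (y * U * M / 0.472) +
          0.28 * (M / 0.472) * (U * (1 - y / j)) ^ (j + 1 + 1) / ((j + 1 : ℕ) : ℝ) := by
          rw [hMx]
          gcongr
      _ = M / 0.472 * U ^ (j + 1) * (y * (1 - y) ^ j / j +
            U * (0.28 * (1 - y / j) ^ (j + 2) / (j + 1))) := by
          rw [mul_pow, mul_pow]
          push_cast
          ring
      _ ≤ M / 0.472 * U ^ (j + 1) * (y * (1 - y) ^ j / j +
            1 * (0.28 * (1 - y / j) ^ (j + 2) / (j + 1))) := by
          gcongr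
      _ ≤ M / 0.472 * U ^ (j + 1) * (0.28 / j) := by
          rw [one_mul]
          gcongr
      _ = _ := by ring

theorem base_step {x : ℝ} (hx0 : 0 ≤ x) (hx1 : x ≤ 1) :
    ∃ i : ℕ, 61 ≤ i ∧ i ≤ 500 ∧ x ≤ (i : ℝ) / 500 ∧
      x * (1 - acceptProb x) + potential 2 i / (10 ^ 4 * 500 ^ 7) ≤ 0.190 := by
  have hcap : x * (1 - acceptProb x) ≤ 0.17365 := by
    rcases hx0.eq_or_lt with rfl | hx
    · norm_num
    · have h1 := le_acceptProb hx
      have h2 : -Real.log x ≤ Real.exp (-1) / x := by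
        have h := Real.log_le_sub_one_of_pos (div_pos (Real.exp_pos (-1)) hx)
        rw [Real.log_div (Real.exp_pos _).ne' hx.ne', Real.log_exp] at h
        linarith
      have h3 : Real.exp (-1) ≤ 1 / 2.7182818283 := by
        rw [Real.exp_neg, ← one_div]
        exact one_div_le_one_div_of_le (by norm_num) Real.exp_one_gt_d9.le
      rw [le_div_iff₀ hx] at h2
      nlinarith
  have hceil : 500 * x ≤ ⌈500 * x⌉₊ := Nat.le_ceil _
  by_cases hs : 500 * x ≤ 61
  · refine ⟨61, le_rfl, by norm_num, by push_cast; linarith, ?_⟩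
    have : (potential 2 61 : ℝ) / (10 ^ 4 * 500 ^ 7) ≤ 0.001 := by
      have : potential 2 61 ≤ 10 * 500 ^ 7 := by decide +kernel
      have : (potential 2 61 : ℝ) ≤ 10 * 500 ^ 7 := by exact_mod_cast this
      rw [div_le_iff₀ (by positivity)]
      linarith
    linarith
  · push Not at hs
    have h500 : ⌈500 * x⌉₊ ≤ 500 := Nat.ceil_le.2 (by push_cast; linarith)
    have h61 : 61 < ⌈500 * x⌉₊ := Nat.lt_ceil.2 (by push_cast; linarith)
    obtain ⟨k, hk⟩ : ∃ k, ⌈500 * x⌉₊ = k + 1 := ⟨⌈500 * x⌉₊ - 1, by omega⟩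
    have hkx : (k : ℝ) < 500 * x := Nat.lt_ceil.1 (by omega)
    rw [hk] at h500 h61 hceil
    refine ⟨k + 1, by omega, h500, by linarith, ?_⟩
    obtain ⟨p, hp, rfl⟩ := exists_mem_logTable (k := k) (by omega) (by omega)
    have hp61 : (61 : ℝ) ≤ p.1 := by exact_mod_cast (by omega : 61 ≤ p.1)
    have hx : 0 < x := by linarith
    rcases base_check p hp (by omega) with ⟨h1, h2⟩ | h
    · have h1' : (52800000 : ℝ) ≤ p.2.2 := by exact_mod_cast h1
      have h2' : (p.1 * 10 ^ 8 * (10 ^ 4 * 500 ^ 6) + potential 2 (p.1 + 1) * 10 ^ 8 : ℝ) ≤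
          19 * 10 ^ 6 * (10 ^ 4 * 500 ^ 7) + p.1 * p.2.2 * (10 ^ 4 * 500 ^ 6) := by
        exact_mod_cast h2
      obtain ⟨hl, -⟩ := logTable_spec p hp
      have h3 := le_acceptProb hx
      obtain ⟨g, hg⟩ : ∃ g : ℝ, g = p.1 / 500 := ⟨_, rfl⟩
      have hg0 : 0 < g := by rw [hg]; positivity
      have hgx : g ≤ x := by rw [hg]; linarith
      rw [← hg] at hl
      have h4 := Real.log_le_sub_one_of_pos (div_pos hg0 hx)
      rw [Real.log_div hg0.ne' hx.ne'] at h4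
      obtain ⟨L, hL⟩ : ∃ L : ℝ, L = p.2.2 / 10 ^ 8 := ⟨_, rfl⟩
      have hL1 : 0.528 ≤ L := by
        rw [hL, le_div_iff₀ (by positivity)]
        linarith
      rw [← hL] at hl
      have h5 : 1 - acceptProb x ≤ 1 - L - 0.472 + 0.472 * (g / x) := by linarith
      have h6 : x * (1 - acceptProb x) ≤ g * (1 - L) := by
        calc x * (1 - acceptProb x) ≤ x * (1 - L - 0.472 + 0.472 * (g / x)) := by gcongr
          _ = x * (1 - L - 0.472) + 0.472 * g := by field_simp
          _ ≤ _ := by nlinarith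
      have h7 : g * (1 - L) + potential 2 (p.1 + 1) / (10 ^ 4 * 500 ^ 7) ≤ 0.190 := by
        have e : g * (1 - L) + potential 2 (p.1 + 1) / (10 ^ 4 * 500 ^ 7) =
            (p.1 * 10 ^ 8 * (10 ^ 4 * 500 ^ 6) + potential 2 (p.1 + 1) * 10 ^ 8 -
              p.1 * p.2.2 * (10 ^ 4 * 500 ^ 6)) / (10 ^ 8 * (10 ^ 4 * 500 ^ 7)) := by
          rw [hg, hL]
          field_simp
          ring
        rw [e, div_le_iff₀ (by positivity)]
        linarith
      linarith
    · have h' : (17365 * (10 ^ 4 * 500 ^ 7) + potential 2 (p.1 + 1) * 10 ^ 5 : ℝ) ≤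
          19000 * (10 ^ 4 * 500 ^ 7) := by exact_mod_cast h
      have : (potential 2 (p.1 + 1) : ℝ) / (10 ^ 4 * 500 ^ 7) ≤ 0.01635 := by
        rw [div_le_iff₀ (by positivity)]
        linarith
      linarith

/-- The value received by the best-only pricing curve, when the smallest value is the last one:
that value is received exactly if it arrives first and passes the threshold. -/
noncomputable def receivedRec (f : ℝ → ℝ) : (n : ℕ) → (Fin n → ℝ) → (Fin n → ℝ) → ℝ
  | 0, _, _ => 0
  | n + 1, x, t =>
    open Classical in
    if f (t (Fin.last n)) ≤ x (Fin.last n) ∧ ∀ i : Fin n, t (Fin.last n) < t i.castSucc then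
      x (Fin.last n)
    else receivedRec f n (fun i => x i.castSucc) fun i => t i.castSucc

theorem bestOnlyReceived_eq_of_min {n : ℕ} {f : ℝ → ℝ} {x t : Fin n → ℝ}
    (ht : Function.Injective t) {i : Fin n} (hi : f (t i) ≤ x i ∧ ∀ j, t j < t i → x j < x i)
    (hmin : ∀ k, (f (t k) ≤ x k ∧ ∀ j, t j < t k → x j < x k) → t i ≤ t k) :
    bestOnlyReceived f x t = x i := by
  have hne : (Finset.univ.filter fun i : Fin n =>
      f (t i) ≤ x i ∧ ∀ j, t j < t i → x j < x i).Nonempty := ⟨i, by simpa using hi⟩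
  rw [bestOnlyReceived, dif_pos hne]
  have hc := Classical.choose_spec (Finset.exists_min_image _ t hne)
  congr 1
  refine ht (le_antisymm (hc.2 i (by simpa using hi)) (hmin _ ?_))
  simpa using hc.1

theorem bestOnlyReceived_eq_zero {n : ℕ} {f : ℝ → ℝ} {x t : Fin n → ℝ}
    (h : ∀ i, ¬ (f (t i) ≤ x i ∧ ∀ j, t j < t i → x j < x i)) :
    bestOnlyReceived f x t = 0 := by
  rw [bestOnlyReceived, dif_neg]
  rintro ⟨i, hi⟩
  exact h i (by simpa using hi)

theorem bestOnlyReceived_eq_receivedRec (f : ℝ → ℝ) {n : ℕ} {x t : Fin n → ℝ}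
    (hx : StrictAnti x) (ht : Function.Injective t) :
    bestOnlyReceived f x t = receivedRec f n x t := by
  induction n with
  | zero => exact bestOnlyReceived_eq_zero fun i => i.elim0
  | succ n ih =>
    rw [receivedRec]
    split_ifs with h
    · have hle : ∀ k, t (Fin.last n) ≤ t k := by
        intro k
        induction k using Fin.lastCases with
        | last => exact le_rfl
        | cast i => exact (h.2 i).le
      exact bestOnlyReceived_eq_of_min ht
        ⟨h.1, fun j hj => absurd hj (not_lt.2 (hle j))⟩ fun k _ => hle k
    · have hx' : StrictAnti fun i : Fin n => x i.castSucc := fun i j hij =>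
        hx (Fin.castSucc_lt_castSucc_iff.2 hij)
      have ht' : Function.Injective fun i : Fin n => t i.castSucc :=
        ht.comp (Fin.castSucc_injective n)
      have hlt : ∀ i : Fin n, x (Fin.last n) < x i.castSucc := fun i => hx (Fin.castSucc_lt_last i)
      rw [← ih hx' ht']
      have hlast : ¬ (f (t (Fin.last n)) ≤ x (Fin.last n) ∧
          ∀ j, t j < t (Fin.last n) → x j < x (Fin.last n)) := by
        rintro ⟨h1, h2⟩
        refine h ⟨h1, fun i => lt_of_le_of_ne (not_lt.1 fun h3 => ?_) fun h3 => ?_⟩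
        · exact (hlt i).not_gt (h2 _ h3)
        · exact (Fin.castSucc_lt_last i).ne' (ht h3)
      have hcast : ∀ i : Fin n, (f (t i.castSucc) ≤ x i.castSucc ∧
          ∀ j, t j < t i.castSucc → x j < x i.castSucc) ↔ (f (t i.castSucc) ≤ x i.castSucc ∧
          ∀ j : Fin n, t j.castSucc < t i.castSucc → x j.castSucc < x i.castSucc) := by
        intro i
        refine and_congr_right fun _ => ⟨fun h j => h j.castSucc, fun h j => ?_⟩
        induction j using Fin.lastCases with
        | last => exact fun _ => hlt i
        | cast j => exact h j
      by_cases hex : ∃ i : Fin n, f (t i.castSucc) ≤ x i.castSucc ∧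
          ∀ j : Fin n, t j.castSucc < t i.castSucc → x j.castSucc < x i.castSucc
      · obtain ⟨i, hi, hmin⟩ := Finset.exists_min_image
          (Finset.univ.filter fun i : Fin n => f (t i.castSucc) ≤ x i.castSucc ∧
            ∀ j : Fin n, t j.castSucc < t i.castSucc → x j.castSucc < x i.castSucc)
          (fun i => t i.castSucc) (by simpa [Finset.Nonempty] using hex)
        have hi' := (Finset.mem_filter.1 hi).2
        rw [bestOnlyReceived_eq_of_min ht' hi' fun k hk =>
          hmin k (Finset.mem_filter.2 ⟨Finset.mem_univ _, hk⟩)]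
        refine bestOnlyReceived_eq_of_min ht ((hcast i).2 hi') fun k => ?_
        induction k using Fin.lastCases with
        | last => exact fun h => absurd h hlast
        | cast k =>
          exact fun hk => hmin k (Finset.mem_filter.2 ⟨Finset.mem_univ _, (hcast k).1 hk⟩)
      · push Not at hex
        rw [bestOnlyReceived_eq_zero (x := fun i : Fin n => x i.castSucc)
          (t := fun i : Fin n => t i.castSucc) fun i hi => by
            obtain ⟨j, h1, h2⟩ := hex i hi.1
            exact h2.not_gt (hi.2 j h1)]
        refine bestOnlyReceived_eq_zero fun k => ?_
        induction k using Fin.lastCases with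
        | last => exact hlast
        | cast k =>
          rw [hcast]
          rintro ⟨h1, h2⟩
          obtain ⟨j, h3, h4⟩ := hex k h1
          exact h4.not_gt (h2 j h3)

theorem measurable_receivedRec {f : ℝ → ℝ} (hf : Measurable f) (n : ℕ) (x : Fin n → ℝ) :
    Measurable (receivedRec f n x) := by
  induction n with
  | zero => exact measurable_const
  | succ n ih =>
    have h : Measurable fun t : Fin (n + 1) → ℝ =>
        receivedRec f n (fun i => x i.castSucc) fun i => t i.castSucc :=
      (ih _).comp (measurable_pi_lambda _ fun i => measurable_pi_apply _)
    refine Measurable.ite ?_ measurable_const h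
    refine MeasurableSet.inter
      (measurableSet_le (hf.comp (measurable_pi_apply _)) measurable_const) ?_
    change MeasurableSet {t : Fin (n + 1) → ℝ | ∀ i : Fin n, t (Fin.last n) < t i.castSucc}
    rw [Set.ofPred_forall]
    exact MeasurableSet.iInter fun i =>
      measurableSet_lt (measurable_pi_apply _) (measurable_pi_apply _)

theorem exists_abs_receivedRec_le (f : ℝ → ℝ) (n : ℕ) (x : Fin n → ℝ) :
    ∃ C, ∀ t, |receivedRec f n x t| ≤ C := by
  induction n with
  | zero => exact ⟨0, fun t => by simp [receivedRec]⟩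
  | succ n ih =>
    obtain ⟨C, hC⟩ := ih fun i => x i.castSucc
    refine ⟨max |x (Fin.last n)| C, fun t => ?_⟩
    rw [receivedRec]
    split_ifs
    · exact le_max_left _ _
    · exact (hC _).trans (le_max_right _ _)

theorem ae_injective_pi (n : ℕ) : ∀ᵐ t : Fin n → ℝ, Function.Injective t := by
  have h : ∀ i j : Fin n, i ≠ j → ∀ᵐ t : Fin n → ℝ, t i ≠ t j := by
    intro i j hij
    let L : (Fin n → ℝ) →ₗ[ℝ] ℝ :=
      LinearMap.proj (R := ℝ) (φ := fun _ : Fin n => ℝ) i -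
        LinearMap.proj (R := ℝ) (φ := fun _ : Fin n => ℝ) j
    have hL : LinearMap.ker L ≠ ⊤ := by
      intro htop
      have : Pi.single i (1 : ℝ) ∈ LinearMap.ker L := htop ▸ Submodule.mem_top
      simp [L, hij.symm] at this
    have h0 := Measure.addHaar_submodule (volume : Measure (Fin n → ℝ)) (LinearMap.ker L) hL
    rw [ae_iff]
    convert h0 using 2
    ext t
    simp [L, sub_eq_zero]
  have h' : ∀ᵐ t : Fin n → ℝ, ∀ i j : Fin n, i ≠ j → t i ≠ t j := by
    rw [ae_all_iff]
    intro i
    rw [ae_all_iff]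
    intro j
    by_cases hij : i = j
    · exact Filter.Eventually.of_forall fun t h => absurd hij h
    · filter_upwards [h i j hij] with t ht _ using ht
  filter_upwards [h'] with t ht i j hij
  by_contra hne
  exact ht i j hne hij

/-- The integral of the received value over arrival times in `(s, 1]`. -/
noncomputable def receivedIntegral (f : ℝ → ℝ) (n : ℕ) (x : Fin n → ℝ) (s : ℝ) : ℝ :=
  ∫ t in Set.univ.pi fun _ : Fin n => Set.Ioc s 1, receivedRec f n x t

theorem bestOnlyRegret_eq {f : ℝ → ℝ} {n : ℕ} {x : Fin (n + 1) → ℝ} (hx : StrictAnti x) :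
    bestOnlyRegret f x = x 0 - receivedIntegral f (n + 1) x 0 := by
  rw [bestOnlyRegret, receivedIntegral]
  congr 1
  have h : (Set.univ.pi fun _ : Fin (n + 1) => Set.Ioc (0 : ℝ) 1) =ᵐ[volume]
      Set.univ.pi fun _ : Fin (n + 1) => Set.Icc (0 : ℝ) 1 := by
    rw [Set.pi_univ_Icc]
    exact Measure.univ_pi_Ioc_ae_eq_Icc
  rw [setIntegral_congr_set h]
  refine setIntegral_congr_ae (MeasurableSet.univ_pi fun _ => measurableSet_Icc) ?_
  filter_upwards [ae_injective_pi (n + 1)] with t ht _ using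
    bestOnlyReceived_eq_receivedRec f hx ht

theorem integrableOn_of_abs_le {n : ℕ} {g : (Fin n → ℝ) → ℝ} (hg : Measurable g) {C : ℝ}
    (hC : ∀ t, |g t| ≤ C) (s : ℝ) :
    IntegrableOn g (Set.univ.pi fun _ : Fin n => Set.Ioc s 1) := by
  refine Measure.integrableOn_of_bounded (M := C) ?_ hg.aestronglyMeasurable
    (Filter.Eventually.of_forall hC)
  rw [Real.volume_pi_Ioc]
  exact ENNReal.prod_ne_top fun _ _ => ENNReal.ofReal_ne_top

theorem setIntegral_pi_Ioc_succ {n : ℕ} {g : (Fin (n + 1) → ℝ) → ℝ} (hg : Measurable g) {C : ℝ}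
    (hC : ∀ t, |g t| ≤ C) (s : ℝ) :
    ∫ t in Set.univ.pi fun _ : Fin (n + 1) => Set.Ioc s 1, g t =
      ∫ r in Set.Ioc s 1, ∫ t in Set.univ.pi fun _ : Fin n => Set.Ioc s 1,
        g (Fin.snoc (α := fun _ => ℝ) t r) := by
  let e := MeasurableEquiv.piFinSuccAbove (fun _ : Fin (n + 1) => ℝ) (Fin.last n)
  have hmp : MeasurePreserving e.symm :=
    (volume_preserving_piFinSuccAbove (fun _ : Fin (n + 1) => ℝ) (Fin.last n)).symm
  have he : ∀ p : ℝ × (Fin n → ℝ), e.symm p = Fin.snoc (α := fun _ => ℝ) p.2 p.1 := by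
    intro p
    change Fin.insertNth (α := fun _ => ℝ) (Fin.last n) p.1 p.2 = _
    exact Fin.insertNth_last' p.1 p.2
  have hpre : e.symm ⁻¹' (Set.univ.pi fun _ : Fin (n + 1) => Set.Ioc s 1) =
      Set.Ioc s 1 ×ˢ Set.univ.pi fun _ : Fin n => Set.Ioc s 1 := by
    ext p
    rw [Set.mem_preimage, he]
    simp only [Set.mem_univ_pi, Set.mem_prod, Fin.forall_fin_succ', Fin.snoc_castSucc,
      Fin.snoc_last]
    exact and_comm
  have hg_int : IntegrableOn (fun p => g (e.symm p))
      (e.symm ⁻¹' (Set.univ.pi fun _ : Fin (n + 1) => Set.Ioc s 1)) :=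
    (hmp.integrableOn_comp_preimage e.symm.measurableEmbedding).2 (integrableOn_of_abs_le hg hC s)
  rw [← hmp.setIntegral_preimage_emb e.symm.measurableEmbedding, hpre]
  rw [hpre] at hg_int
  rw [Measure.volume_eq_prod] at hg_int ⊢
  rw [setIntegral_prod _ hg_int]
  simp only [he]

theorem receivedIntegral_inner {f : ℝ → ℝ} (hf : Measurable f) {n : ℕ} (x : Fin (n + 1) → ℝ)
    {s r : ℝ} (hs : s < r) (hr : r ≤ 1) :
    ∫ t in Set.univ.pi fun _ : Fin n => Set.Ioc s 1,
        receivedRec f (n + 1) x (Fin.snoc (α := fun _ => ℝ) t r) =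
      receivedIntegral f n (fun i => x i.castSucc) s +
        {r | f r ≤ x (Fin.last n)}.indicator (fun r => (1 - r) ^ n * x (Fin.last n) -
          receivedIntegral f n (fun i => x i.castSucc) r) r := by
  have hmeas := measurable_receivedRec hf n fun i => x i.castSucc
  obtain ⟨C, hC⟩ := exists_abs_receivedRec_le f n fun i => x i.castSucc
  by_cases h : f r ≤ x (Fin.last n)
  · have hB : MeasurableSet (Set.univ.pi fun _ : Fin n => Set.Ioi r) :=
      MeasurableSet.univ_pi fun _ => measurableSet_Ioi
    have hinter : (Set.univ.pi fun _ : Fin n => Set.Ioc s 1) ∩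
        (Set.univ.pi fun _ : Fin n => Set.Ioi r) = Set.univ.pi fun _ : Fin n => Set.Ioc r 1 := by
      rw [← Set.pi_inter_distrib]
      congr 1
      ext i y
      exact ⟨fun h => ⟨h.2, h.1.2⟩, fun h => ⟨⟨hs.trans h.1, h.2⟩, h.1⟩⟩
    have hpt : ∀ t : Fin n → ℝ, receivedRec f (n + 1) x (Fin.snoc (α := fun _ => ℝ) t r) =
        receivedRec f n (fun i => x i.castSucc) t +
        (Set.univ.pi fun _ : Fin n => Set.Ioi r).indicator
          (fun t => x (Fin.last n) - receivedRec f n (fun i => x i.castSucc) t) t := by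
      intro t
      rw [receivedRec]
      simp only [Fin.snoc_last, Fin.snoc_castSucc, h, true_and]
      by_cases hall : ∀ i, r < t i
      · rw [if_pos hall, Set.indicator_of_mem (by simpa using hall)]
        ring
      · rw [if_neg hall, Set.indicator_of_notMem (by simpa using hall), add_zero]
    have hint1 := integrableOn_of_abs_le hmeas hC
    have hconst : ∀ s, IntegrableOn (fun _ : Fin n → ℝ => x (Fin.last n))
        (Set.univ.pi fun _ : Fin n => Set.Ioc s 1) := fun s =>
      integrableOn_of_abs_le measurable_const (fun _ => le_rfl) s
    have hvol : volume.real (Set.univ.pi fun _ : Fin n => Set.Ioc r 1) = (1 - r) ^ n := by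
      rw [measureReal_def, Real.volume_pi_Ioc]
      simp [ENNReal.toReal_ofReal (sub_nonneg.2 hr)]
    have hsub : IntegrableOn
        (fun t => x (Fin.last n) - receivedRec f n (fun i => x i.castSucc) t)
        (Set.univ.pi fun _ : Fin n => Set.Ioc s 1) := (hconst s).sub (hint1 s)
    simp_rw [hpt]
    rw [integral_add (hint1 s) (hsub.indicator hB),
      setIntegral_indicator hB, hinter, integral_sub (hconst r) (hint1 r), setIntegral_const,
      hvol, Set.indicator_of_mem (by exact h), smul_eq_mul]
    rfl
  · rw [Set.indicator_of_notMem (by exact h), add_zero, receivedIntegral]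
    congr 1
    ext t
    rw [receivedRec, if_neg]
    · simp only [Fin.snoc_castSucc]
    · simp only [Fin.snoc_last]
      exact fun h' => h h'.1

theorem receivedIntegral_succ {f : ℝ → ℝ} (hf : Measurable f) {n : ℕ} (x : Fin (n + 1) → ℝ)
    (s : ℝ) :
    receivedIntegral f (n + 1) x s = ∫ r in Set.Ioc s 1,
      (receivedIntegral f n (fun i => x i.castSucc) s +
        {r | f r ≤ x (Fin.last n)}.indicator (fun r => (1 - r) ^ n * x (Fin.last n) -
          receivedIntegral f n (fun i => x i.castSucc) r) r) := by
  obtain ⟨C, hC⟩ := exists_abs_receivedRec_le f (n + 1) x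
  rw [receivedIntegral, setIntegral_pi_Ioc_succ (measurable_receivedRec hf _ x) hC]
  exact setIntegral_congr_fun measurableSet_Ioc fun r hr => receivedIntegral_inner hf x hr.1 hr.2

theorem integral_Ioc_one_sub_pow (n : ℕ) {s : ℝ} (hs : s ≤ 1) :
    ∫ r in Set.Ioc s 1, (1 - r) ^ n = (1 - s) ^ (n + 1) / (n + 1) := by
  rw [← intervalIntegral.integral_of_le hs,
    intervalIntegral.integral_comp_sub_left (fun r => r ^ n) 1, integral_pow]
  simp

theorem receivedIntegral_of_le {f : ℝ → ℝ} (hf : Antitone f) {n : ℕ} {x : Fin n → ℝ} {s : ℝ}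
    (hs : s ≤ 1) (h : ∀ i, f s ≤ x i) :
    receivedIntegral f n x s = (1 - s) ^ n * ((∑ i, x i) / n) := by
  induction n generalizing s with
  | zero => simp [receivedIntegral, receivedRec]
  | succ n ih =>
    rw [receivedIntegral_succ hf.measurable, ih hs fun i => h _]
    have hcongr : ∀ r ∈ Set.Ioc s 1, ((1 - s) ^ n * ((∑ i : Fin n, x i.castSucc) / n) +
        {r | f r ≤ x (Fin.last n)}.indicator (fun r => (1 - r) ^ n * x (Fin.last n) -
          receivedIntegral f n (fun i => x i.castSucc) r) r) =
        (1 - s) ^ n * ((∑ i : Fin n, x i.castSucc) / n) +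
          (1 - r) ^ n * (x (Fin.last n) - (∑ i : Fin n, x i.castSucc) / n) := by
      intro r hr
      have hfr : f r ≤ f s := hf hr.1.le
      rw [Set.indicator_of_mem (show r ∈ {r | f r ≤ x (Fin.last n)} from hfr.trans (h _)),
        ih hr.2 fun i => hfr.trans (h _)]
      ring
    rw [setIntegral_congr_fun measurableSet_Ioc hcongr, integral_add, setIntegral_const,
      integral_mul_const, integral_Ioc_one_sub_pow n hs, Fin.sum_univ_castSucc]
    · rw [measureReal_def, Real.volume_Ioc, ENNReal.toReal_ofReal (sub_nonneg.2 hs), smul_eq_mul]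
      push_cast
      rcases Nat.eq_zero_or_pos n with rfl | hn
      · simp
      · have : (0 : ℝ) < n := by exact_mod_cast hn
        field_simp
        ring
    · exact integrableOn_const (by simp)
    · exact (Continuous.integrableOn_Ioc (by fun_prop))

theorem receivedIntegral_succ_zero {f : ℝ → ℝ} (hf : Antitone f) {n : ℕ} {x : Fin (n + 1) → ℝ}
    (hx : Antitone x) :
    receivedIntegral f (n + 1) x 0 = receivedIntegral f n (fun i => x i.castSucc) 0 +
      (∫ r in Set.Ioc 0 1 ∩ {r | f r ≤ x (Fin.last n)}, (1 - r) ^ n) *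
        (x (Fin.last n) - (∑ i : Fin n, x i.castSucc) / n) := by
  have hS : MeasurableSet {r | f r ≤ x (Fin.last n)} :=
    measurableSet_le hf.measurable measurable_const
  rw [receivedIntegral_succ hf.measurable]
  have hcongr : ∀ r ∈ Set.Ioc (0 : ℝ) 1, (receivedIntegral f n (fun i => x i.castSucc) 0 +
      {r | f r ≤ x (Fin.last n)}.indicator (fun r => (1 - r) ^ n * x (Fin.last n) -
        receivedIntegral f n (fun i => x i.castSucc) r) r) =
      receivedIntegral f n (fun i => x i.castSucc) 0 +
        {r | f r ≤ x (Fin.last n)}.indicator (fun r => (1 - r) ^ n *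
          (x (Fin.last n) - (∑ i : Fin n, x i.castSucc) / n)) r := by
    intro r hr
    congr 1
    by_cases h : f r ≤ x (Fin.last n)
    · rw [Set.indicator_of_mem (by exact h), Set.indicator_of_mem (by exact h),
        receivedIntegral_of_le hf hr.2 fun i => h.trans (hx (Fin.le_last _))]
      ring
    · rw [Set.indicator_of_notMem (by exact h), Set.indicator_of_notMem (by exact h)]
  have hg_int : IntegrableOn (fun r : ℝ => (1 - r) ^ n *
      (x (Fin.last n) - (∑ i : Fin n, x i.castSucc) / n)) (Set.Ioc 0 1) :=
    Continuous.integrableOn_Ioc (by fun_prop)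
  have hc : IntegrableOn (fun _ : ℝ => receivedIntegral f n (fun i => x i.castSucc) 0)
      (Set.Ioc 0 1) := integrableOn_const (by simp)
  rw [setIntegral_congr_fun measurableSet_Ioc hcongr,
    integral_add hc (hg_int.indicator hS), setIntegral_const,
    setIntegral_indicator hS, integral_mul_const]
  simp

theorem setIntegral_exp_le_eq {x : ℝ} (hx : x ≤ 1) (n : ℕ) :
    ∫ r in Set.Ioc 0 1 ∩ {r | Real.exp (-r / 0.472) ≤ x}, (1 - r) ^ n =
      acceptProb x ^ (n + 1) / (n + 1) := by
  rcases le_or_gt x 0 with h0 | h0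
  · have hempty : Set.Ioc 0 1 ∩ {r : ℝ | Real.exp (-r / 0.472) ≤ x} = ∅ := by
      ext r
      simp only [Set.mem_inter_iff, Set.mem_ofPred_eq, Set.mem_empty_iff_false, iff_false]
      exact fun h => (h.2.trans h0).not_gt (Real.exp_pos _)
    simp [hempty, acceptProb, h0.not_gt]
  have hle : 0 ≤ 1 - acceptProb x := sub_nonneg.2 (acceptProb_le_one hx)
  have hset : ∀ᵐ r, r ∈ Set.Ioc 0 1 ∩ {r : ℝ | Real.exp (-r / 0.472) ≤ x} ↔
      r ∈ Set.Ioc (1 - acceptProb x) 1 := by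
    filter_upwards [compl_mem_ae_iff.2 (measure_singleton (μ := volume) (1 - acceptProb x))]
      with r hr
    have hne : r ≠ 1 - acceptProb x := hr
    refine ⟨fun h => ?_, fun h => ?_⟩
    · obtain ⟨⟨h1, h2⟩, h3⟩ := h
      have h4 := (Real.le_log_iff_exp_le h0).2 h3
      have h5 : -r / 0.472 * 0.472 = -r := div_mul_cancel₀ _ (by norm_num)
      refine ⟨lt_of_le_of_ne ?_ hne.symm, h2⟩
      linarith [le_acceptProb h0]
    · refine ⟨⟨hle.trans_lt h.1, h.2⟩, ?_⟩
      refine (Real.le_log_iff_exp_le h0).1 ?_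
      have h1 : 1 - r < acceptProb x := by linarith [h.1]
      rw [acceptProb, if_pos h0, lt_max_iff] at h1
      have h5 : -r / 0.472 * 0.472 = -r := div_mul_cancel₀ _ (by norm_num)
      rcases h1 with h1 | h1
      · linarith [h.2]
      · linarith
  rw [setIntegral_congr_set (Filter.eventuallyEq_set.2 hset), integral_Ioc_one_sub_pow n (by linarith [acceptProb_nonneg x])]
  congr 2
  ring

theorem antitone_exp_neg_div : Antitone fun t : ℝ => Real.exp (-t / 0.472) := by
  intro a b h
  have : -b / 0.472 ≤ -a / 0.472 := by gcongr
  simpa using this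

theorem bestOnlyRegret_one {x : Fin 1 → ℝ} (hx : StrictAnti x) (hx1 : x 0 ≤ 1) :
    bestOnlyRegret (fun t => Real.exp (-t / 0.472)) x = x 0 * (1 - acceptProb (x 0)) := by
  have h := setIntegral_exp_le_eq hx1 0
  rw [bestOnlyRegret_eq hx, receivedIntegral_succ_zero antitone_exp_neg_div hx.antitone,
    Fin.last_zero, h]
  simp [receivedIntegral, receivedRec]
  ring

theorem bestOnlyRegret_succ {n : ℕ} {x : Fin (n + 2) → ℝ} (hx : StrictAnti x) (hx1 : x 0 ≤ 1) :
    bestOnlyRegret (fun t => Real.exp (-t / 0.472)) x =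
      bestOnlyRegret (fun t => Real.exp (-t / 0.472)) (fun i : Fin (n + 1) => x i.castSucc) +
        acceptProb (x (Fin.last _)) ^ (n + 2) / ((n + 2 : ℕ) : ℝ) *
          ((∑ i : Fin (n + 1), x i.castSucc) / ((n + 1 : ℕ) : ℝ) - x (Fin.last _)) := by
  have hx' : StrictAnti fun i : Fin (n + 1) => x i.castSucc := fun i j hij =>
    hx (Fin.castSucc_lt_castSucc_iff.2 hij)
  rw [bestOnlyRegret_eq hx, bestOnlyRegret_eq hx',
    receivedIntegral_succ_zero antitone_exp_neg_div hx.antitone,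
    setIntegral_exp_le_eq ((hx.antitone (Fin.zero_le _)).trans hx1)]
  have h0 : (0 : Fin (n + 1)).castSucc = 0 := rfl
  rw [h0]
  push_cast
  ring

/-- The regret of an instance, plus a potential of the mean of its values that accounts for
all the values still to come, stays below `0.190`. -/
theorem bestOnlyRegret_add_potential_le (n : ℕ) (x : Fin (n + 1) → ℝ) (hx : StrictAnti x)
    (hx1 : x 0 ≤ 1) (hx0 : 0 ≤ x (Fin.last n)) :
    (n ≤ 6 → ∃ i : ℕ, 61 ≤ i ∧ i ≤ 500 ∧ (∑ i, x i) / ((n + 1 : ℕ) : ℝ) ≤ i / 500 ∧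
      bestOnlyRegret (fun t => Real.exp (-t / 0.472)) x +
        potential (n + 2) i / (10 ^ 4 * 500 ^ 7) ≤ 0.190) ∧
    (6 ≤ n → bestOnlyRegret (fun t => Real.exp (-t / 0.472)) x +
      tailPotential (n + 2) ((∑ i, x i) / ((n + 1 : ℕ) : ℝ)) ≤ 0.190) := by
  induction n with
  | zero =>
    refine ⟨fun _ => ?_, fun h => absurd h (by norm_num)⟩
    obtain ⟨i, h1, h2, h3, h4⟩ := base_step hx0 hx1
    refine ⟨i, h1, h2, by simpa using h3, ?_⟩
    rw [bestOnlyRegret_one hx hx1]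
    exact h4
  | succ n ih =>
    have hx' : StrictAnti fun i : Fin (n + 1) => x i.castSucc := fun i j hij =>
      hx (Fin.castSucc_lt_castSucc_iff.2 hij)
    obtain ⟨ih1, ih2⟩ := ih (fun i => x i.castSucc) hx' hx1
      (hx0.trans (hx.antitone (Fin.le_last _)))
    have hreg := bestOnlyRegret_succ hx hx1
    have hn : (0 : ℝ) < ((n + 1 : ℕ) : ℝ) := by positivity
    have hmean : (∑ i, x i) / ((n + 1 + 1 : ℕ) : ℝ) =
        (∑ i : Fin (n + 1), x i.castSucc) / ((n + 1 : ℕ) : ℝ) -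
          ((∑ i : Fin (n + 1), x i.castSucc) / ((n + 1 : ℕ) : ℝ) - x (Fin.last _)) /
            ((n + 2 : ℕ) : ℝ) := by
      rw [Fin.sum_univ_castSucc]
      push_cast at hn ⊢
      field_simp
      ring
    have hlast : x (Fin.last (n + 1)) ≤
        (∑ i : Fin (n + 1), x i.castSucc) / ((n + 1 : ℕ) : ℝ) := by
      rw [le_div_iff₀ hn]
      calc x (Fin.last (n + 1)) * ((n + 1 : ℕ) : ℝ)
          = ∑ _i : Fin (n + 1), x (Fin.last (n + 1)) := by simp [mul_comm]
        _ ≤ _ := Finset.sum_le_sum fun i _ => hx.antitone (Fin.le_last _)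
    have hone : (∑ i : Fin (n + 1), x i.castSucc) / ((n + 1 : ℕ) : ℝ) ≤ 1 := by
      rw [div_le_one hn]
      calc ∑ i : Fin (n + 1), x i.castSucc ≤ ∑ _i : Fin (n + 1), (1 : ℝ) :=
            Finset.sum_le_sum fun i _ => (hx.antitone (Fin.zero_le _)).trans hx1
        _ = _ := by simp
    have hgrid : n + 1 ≤ 6 → ∃ i : ℕ, 61 ≤ i ∧ i ≤ 500 ∧
        (∑ i, x i) / ((n + 1 + 1 : ℕ) : ℝ) ≤ i / 500 ∧
        bestOnlyRegret (fun t => Real.exp (-t / 0.472)) x +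
          potential (n + 1 + 2) i / (10 ^ 4 * 500 ^ 7) ≤ 0.190 := by
      intro h
      obtain ⟨i, h1, h2, h3, h4⟩ := ih1 (by omega)
      obtain ⟨i', h1', h2', h3', h4'⟩ :=
        grid_step (j := n + 2) (by omega) (by omega) h1 h2 h3 hlast
      refine ⟨i', h1', h2', hmean.trans_le h3', ?_⟩
      rw [hreg]
      linarith
    refine ⟨hgrid, fun h => ?_⟩
    rcases h.eq_or_lt with h6 | h6
    · obtain ⟨i, h1, h2, h3, h4⟩ := hgrid h6.ge
      obtain rfl : n = 5 := by omega
      have := tailPotential_eight_le h1 h2 h3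
      linarith
    · have := tail_step (j := n + 2) (by omega) hx0 hlast hone
      have h' := ih2 (by omega)
      rw [hreg, hmean]
      linarith

/-- For every instance with pairwise distinct values `1 ≥ x_1 > x_2 > … > x_n ≥ 0`
(with `n ≥ 1` values), the best-only pricing curve with threshold `f(t) = exp(-t/0.472)`
has regret at most `0.190`. -/
theorem bestOnly_exp_0472_regret_le (n : ℕ) (x : Fin (n + 1) → ℝ)
    (hanti : StrictAnti x) (hx1 : x 0 ≤ 1) (hx0 : 0 ≤ x (Fin.last n)) :
    bestOnlyRegret (fun t => Real.exp (-t / 0.472)) x ≤ 0.190 := by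
  obtain ⟨h1, h2⟩ := bestOnlyRegret_add_potential_le n x hanti hx1 hx0
  rcases le_total n 6 with h | h
  · obtain ⟨i, -, -, -, hi⟩ := h1 h
    have : (0 : ℝ) ≤ potential (n + 2) i / (10 ^ 4 * 500 ^ 7) := by positivity
    linarith
  · have hsum : 0 ≤ ∑ i, x i :=
      Finset.sum_nonneg fun i _ => hx0.trans (hanti.antitone (Fin.le_last i))
    have hpow := pow_nonneg (acceptProb_nonneg ((∑ i, x i) / ((n + 1 : ℕ) : ℝ))) (n + 2 + 1)
    have : 0 ≤ tailPotential (n + 2) ((∑ i, x i) / ((n + 1 : ℕ) : ℝ)) := by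
      unfold tailPotential
      positivity
    have := h2 h
    linarith
end

section
/- Let M = 100000 and consider the three value vectors of length M: v⁽¹⁾ with one entry equal to 1, one entry equal to 0.59, one entry equal to 0.38, and M−3 entries equal to 0; v⁽²⁾ with one entry 0.59, one entry 0.38, and M−2 zeros; and v⁽³⁾ with one entry 0.38 and M−1 zeros. Then for every deterministic online selection rule π, 0.46·R(v⁽¹⁾) + 0.27·R(v⁽²⁾) + 0.27·R(v⁽³⁾) ≥ 0.152, where R(v) denotes the expected regret of π on v under a uniformly random arrival order. (By Yao's minimax principle, this implies that no algorithm for the secretary problem with regret-minimization objective, even randomized, has worst-case regret less than 0.152.) -/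
/-- The value received by a deterministic online selection rule `π` (which maps the
sequence of values observed so far, current value last, to `true` = accept) on the
sequence `y 0, y 1, …, y m`: it receives `y i` for the least index `i < m` at which `π`
accepts the prefix `y 0, …, y i`, and receives the last value `y m` if it never accepts. -/
noncomputable def onlineReceived {m : ℕ} (π : List ℝ → Bool) (y : Fin (m + 1) → ℝ) : ℝ :=
  let l := List.ofFn y
  let S := Finset.univ.filter fun i : Fin (m + 1) =>
    (i : ℕ) < m ∧ π (l.take ((i : ℕ) + 1)) = true
  if h : S.Nonempty then y (S.min' h) else y (Fin.last m)

/-- The expected regret of the deterministic online selection rule `π` on the value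
vector `v`, under a uniformly random arrival order: the maximum entry of `v` minus the
average over all permutations `σ` of the value received on the sequence `v ∘ σ`. -/
noncomputable def permRegret {m : ℕ} (π : List ℝ → Bool) (v : Fin (m + 1) → ℝ) : ℝ :=
  Finset.univ.sup' Finset.univ_nonempty v
    - (∑ σ : Equiv.Perm (Fin (m + 1)), onlineReceived π (v ∘ σ)) / (Nat.factorial (m + 1))

/-- The rule `π` stops at position `t` of `y` if it gets that far. -/
def stopsAt {m : ℕ} (π : List ℝ → Bool) (y : Fin (m + 1) → ℝ) (t : Fin (m + 1)) : Prop :=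
  t = Fin.last m ∨ π ((List.ofFn y).take ((t : ℕ) + 1)) = true

lemma stopsAt_congr {m : ℕ} {π : List ℝ → Bool} {y z : Fin (m + 1) → ℝ} {t : Fin (m + 1)}
    (h : ∀ s ≤ t, y s = z s) : stopsAt π y t ↔ stopsAt π z t := by
  have : (List.ofFn y).take ((t : ℕ) + 1) = (List.ofFn z).take ((t : ℕ) + 1) := by
    apply List.ext_getElem
    · simp
    · intro i h1 h2
      simp only [List.getElem_take, List.getElem_ofFn]
      apply h
      simp only [List.length_take, List.length_ofFn] at h1
      rw [Fin.le_def]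
      simp only
      omega
  rw [stopsAt, stopsAt, this]

lemma exists_stopsAt_onlineReceived {m : ℕ} (π : List ℝ → Bool) (y : Fin (m + 1) → ℝ) :
    ∃ t, onlineReceived π y = y t ∧ stopsAt π y t ∧ ∀ s, stopsAt π y s → t ≤ s := by
  unfold onlineReceived
  dsimp only
  split_ifs with h
  · refine ⟨_, rfl, ?_, fun s hs => ?_⟩
    · have := Finset.min'_mem _ h
      simp only [Finset.mem_filter] at this
      exact Or.inr this.2.2
    by_cases hl : s = Fin.last m
    · subst hl; exact Fin.le_last _
    · apply Finset.min'_le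
      have : (s : ℕ) < m := by
        have := Fin.val_lt_last hl
        simpa using this
      simpa [this] using hs.resolve_left hl
  · refine ⟨_, rfl, Or.inl rfl, fun s hs => ?_⟩
    rcases hs with rfl | hs
    · exact le_rfl
    · by_contra hlt
      apply h
      refine ⟨s, ?_⟩
      have : (s : ℕ) < m := by simpa using Fin.lt_def.1 (not_le.1 hlt)
      simpa [this] using hs

/-- The sequence with values `1`, `0.59`, `0.38` at positions `i`, `j`, `k`, and `0` elsewhere. -/
noncomputable def arrival₁ {m : ℕ} (i j k s : Fin (m + 1)) : ℝ :=
  if s = i then 1 else if s = j then 0.59 else if s = k then 0.38 else 0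

/-- The sequence with values `0.59`, `0.38` at positions `j`, `k`, and `0` elsewhere. -/
noncomputable def arrival₂ {m : ℕ} (j k s : Fin (m + 1)) : ℝ :=
  if s = j then 0.59 else if s = k then 0.38 else 0

/-- The sequence with value `u` at position `k`, and `0` elsewhere. -/
noncomputable def arrivalSingle {m : ℕ} (u : ℝ) (k s : Fin (m + 1)) : ℝ :=
  if s = k then u else 0

open Classical in
/-- Upper bound for the weighted reward collected when the value `u` arrives first of the three
positive values, at position `k`; `p` says that it is then taken, `q` that the other non-maximal
value `u'`, arriving later at position `j`, is taken, and `i` is the position of the value `1`.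
The weight `c` belongs to the instance in which `u` is the only positive value. -/
noncomputable def firstReward {m : ℕ} (c u u' : ℝ) (p : Prop) (q : Fin (m + 1) → Prop)
    (k i j : Fin (m + 1)) : ℝ :=
  if p then c * u + (if k < j then 0.27 * u else 0) + (if k < i ∧ k < j then 0.46 * u else 0)
  else (if k < j then 0.27 * (if q j then u' else 0) else 0)
    + (if k < i ∧ k < j then 0.46 * (if j < i ∧ q j then u' else 1) else 0)

open Classical in
lemma weighted_received_le {m : ℕ} (π : List ℝ → Bool) {i j k : Fin (m + 1)}
    (hij : i ≠ j) (hik : i ≠ k) (hjk : j ≠ k) :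
    0.46 * onlineReceived π (arrival₁ i j k) + 0.27 * onlineReceived π (arrival₂ j k)
        + 0.27 * onlineReceived π (arrivalSingle 0.38 k)
      ≤ firstReward 0.27 0.38 0.59 (stopsAt π (arrivalSingle 0.38 k) k)
          (fun j => stopsAt π (arrival₂ j k) j) k i j
        + firstReward 0 0.59 0.38 (stopsAt π (arrivalSingle 0.59 j) j)
          (fun k => stopsAt π (arrival₂ j k) k) j i k
        + (if i < j ∧ i < k then 0.46 else 0) := by
  obtain ⟨t₁, e₁, s₁, f₁⟩ := exists_stopsAt_onlineReceived π (arrival₁ i j k)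
  obtain ⟨t₂, e₂, s₂, f₂⟩ := exists_stopsAt_onlineReceived π (arrival₂ j k)
  obtain ⟨t₃, e₃, s₃, f₃⟩ := exists_stopsAt_onlineReceived π (arrivalSingle 0.38 k)
  have r₃ : onlineReceived π (arrivalSingle 0.38 k) ≤
      if stopsAt π (arrivalSingle 0.38 k) k then 0.38 else 0 := by
    rw [e₃]
    by_cases h : t₃ = k
    · subst h; simp [s₃, arrivalSingle]
    · simp only [arrivalSingle, h, if_false]; split_ifs <;> norm_num
  have r₂ : onlineReceived π (arrival₂ j k) ≤
      if k < j then (if stopsAt π (arrivalSingle 0.38 k) k then 0.38 else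
        if stopsAt π (arrival₂ j k) j then 0.59 else 0)
      else (if stopsAt π (arrivalSingle 0.59 j) j then 0.59 else
        if stopsAt π (arrival₂ j k) k then 0.38 else 0) := by
    have c₁ : k < j → (stopsAt π (arrivalSingle 0.38 k) k ↔ stopsAt π (arrival₂ j k) k) :=
      fun h => stopsAt_congr fun s hs => by
        have : s ≠ j := (hs.trans_lt h).ne
        simp [arrivalSingle, arrival₂, this]
    have c₂ : j < k → (stopsAt π (arrivalSingle 0.59 j) j ↔ stopsAt π (arrival₂ j k) j) :=
      fun h => stopsAt_congr fun s hs => by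
        have : s ≠ k := (hs.trans_lt h).ne
        simp [arrivalSingle, arrival₂, this]
    rw [e₂]
    have hv : (t₂ = j ∧ arrival₂ j k t₂ = 0.59) ∨ (t₂ = k ∧ arrival₂ j k t₂ = 0.38) ∨
        arrival₂ j k t₂ = 0 := by
      unfold arrival₂; split_ifs <;> simp_all
    have g₁ := f₂ j
    have g₂ := f₂ k
    rcases lt_or_gt_of_ne hjk with h | h
    · rw [if_neg (not_lt.2 h.le), c₂ h]
      rcases hv with ⟨rfl, hv⟩ | ⟨rfl, hv⟩ | hv
      · rw [hv]; simp [s₂]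
      · have : ¬ stopsAt π (arrival₂ j t₂) j := fun hh => absurd (g₁ hh) (not_le.2 h)
        rw [hv]; simp [s₂, this]
      · rw [hv]; split_ifs <;> norm_num
    · rw [if_pos h, c₁ h]
      rcases hv with ⟨rfl, hv⟩ | ⟨rfl, hv⟩ | hv
      · have : ¬ stopsAt π (arrival₂ t₂ k) k := fun hh => absurd (g₂ hh) (not_le.2 h)
        rw [hv]; simp [s₂, this]
      · rw [hv]; simp [s₂]
      · rw [hv]; split_ifs <;> norm_num
  have hv : (t₁ = i ∧ arrival₁ i j k t₁ = 1) ∨ (t₁ = j ∧ arrival₁ i j k t₁ = 0.59) ∨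
      (t₁ = k ∧ arrival₁ i j k t₁ = 0.38) ∨ arrival₁ i j k t₁ = 0 := by
    unfold arrival₁; split_ifs <;> simp_all
  have r₁ : onlineReceived π (arrival₁ i j k) ≤
      if i < j ∧ i < k then 1
      else if k < j then (if stopsAt π (arrivalSingle 0.38 k) k then 0.38 else
        if j < i ∧ stopsAt π (arrival₂ j k) j then 0.59 else 1)
      else (if stopsAt π (arrivalSingle 0.59 j) j then 0.59 else
        if k < i ∧ stopsAt π (arrival₂ j k) k then 0.38 else 1) := by
    have c₁ : k < j → k < i → (stopsAt π (arrivalSingle 0.38 k) k ↔ stopsAt π (arrival₁ i j k) k) :=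
      fun h h' => stopsAt_congr fun s hs => by
        simp [arrivalSingle, arrival₁, (hs.trans_lt h).ne, (hs.trans_lt h').ne]
    have c₂ : j < k → j < i → (stopsAt π (arrivalSingle 0.59 j) j ↔ stopsAt π (arrival₁ i j k) j) :=
      fun h h' => stopsAt_congr fun s hs => by
        simp [arrivalSingle, arrival₁, (hs.trans_lt h).ne, (hs.trans_lt h').ne]
    have c₃ : j < i → (stopsAt π (arrival₂ j k) j ↔ stopsAt π (arrival₁ i j k) j) :=
      fun h => stopsAt_congr fun s hs => by simp [arrival₂, arrival₁, (hs.trans_lt h).ne]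
    have c₄ : k < i → (stopsAt π (arrival₂ j k) k ↔ stopsAt π (arrival₁ i j k) k) :=
      fun h => stopsAt_congr fun s hs => by simp [arrival₂, arrival₁, (hs.trans_lt h).ne]
    have g₁ := f₁ j
    have g₂ := f₁ k
    rw [e₁]
    clear e₁ e₂ e₃ f₁ f₂ f₃ s₂ s₃ r₂ r₃
    generalize stopsAt π (arrivalSingle 0.38 k) k = p at *
    generalize stopsAt π (arrivalSingle 0.59 j) j = p' at *
    generalize stopsAt π (arrival₂ j k) j = q at *
    generalize stopsAt π (arrival₂ j k) k = q' at *
    rcases hv with ⟨rfl, hv⟩ | ⟨rfl, hv⟩ | ⟨rfl, hv⟩ | hv <;> rw [hv] <;> split_ifs <;>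
      first
      | norm_num; done
      | (exfalso; grind)
  generalize stopsAt π (arrivalSingle 0.38 k) k = p at *
  generalize stopsAt π (arrivalSingle 0.59 j) j = p' at *
  generalize hq : stopsAt π (arrival₂ j k) j = q at *
  generalize hq' : stopsAt π (arrival₂ j k) k = q' at *
  clear hv f₁ f₂ f₃ s₁ s₂ s₃ e₁ e₂ e₃
  unfold firstReward
  simp only [hq, hq']
  clear hq hq'
  generalize onlineReceived π (arrival₁ i j k) = a₁ at *
  generalize onlineReceived π (arrival₂ j k) = a₂ at *
  generalize onlineReceived π (arrivalSingle 0.38 k) = a₃ at *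
  rcases lt_or_gt_of_ne hij with h₁ | h₁ <;> rcases lt_or_gt_of_ne hik with h₂ | h₂ <;>
    rcases lt_or_gt_of_ne hjk with h₃ | h₃ <;>
    first
    | (exfalso; order)
    | (simp only [h₁, h₂, h₃, not_lt.2 h₁.le, not_lt.2 h₂.le, not_lt.2 h₃.le, and_self, and_true,
        and_false, true_and, false_and, if_true, if_false] at *
       by_cases hp : p <;> by_cases hp' : p' <;> by_cases hq : q <;> by_cases hq' : q' <;>
         simp only [hp, hp', hq, hq', if_true, if_false] at * <;> linarith)

lemma exists_perm_three {N : ℕ} {x y z i j k : Fin N} (hxy : x ≠ y) (hxz : x ≠ z) (hyz : y ≠ z)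
    (hij : i ≠ j) (hik : i ≠ k) (hjk : j ≠ k) :
    ∃ g : Equiv.Perm (Fin N), g x = i ∧ g y = j ∧ g z = k := by
  have inj {a b c : Fin N} (h₁ : a ≠ b) (h₂ : a ≠ c) (h₃ : b ≠ c) :
      Function.Injective ![a, b, c] := by
    intro p q h
    fin_cases p <;> fin_cases q <;> simp_all
  obtain ⟨g, hg⟩ := (Equiv.Perm.isMultiplyPretransitive (Fin N) 3).exists_smul_eq
    ⟨_, inj hxy hxz hyz⟩ ⟨_, inj hij hik hjk⟩
  refine ⟨g, ?_, ?_, ?_⟩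
  · simpa using DFunLike.congr_fun hg 0
  · simpa using DFunLike.congr_fun hg 1
  · simpa using DFunLike.congr_fun hg 2

/-- The ordered triples of distinct positions. -/
def distinctTriples (N : ℕ) : Finset (Fin N × Fin N × Fin N) :=
  Finset.univ.filter fun t => t.1 ≠ t.2.1 ∧ t.1 ≠ t.2.2 ∧ t.2.1 ≠ t.2.2

lemma card_mul_sum_perm {N : ℕ} {x y z : Fin N} (hxy : x ≠ y) (hxz : x ≠ z) (hyz : y ≠ z)
    (F : Fin N → Fin N → Fin N → ℝ) :
    ((distinctTriples N).card : ℝ) * ∑ σ : Equiv.Perm (Fin N), F (σ.symm x) (σ.symm y) (σ.symm z)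
      = (N.factorial : ℝ) * ∑ t ∈ distinctTriples N, F t.1 t.2.1 t.2.2 := by
  calc _ = ∑ t ∈ distinctTriples N, ∑ σ : Equiv.Perm (Fin N),
        F (σ.symm t.1) (σ.symm t.2.1) (σ.symm t.2.2) := by
        rw [← nsmul_eq_mul, ← Finset.sum_const]
        refine Finset.sum_congr rfl ?_
        rintro ⟨i, j, k⟩ ht
        simp only [distinctTriples, Finset.mem_filter, Finset.mem_univ, true_and] at ht
        obtain ⟨g, rfl, rfl, rfl⟩ := exists_perm_three hxy hxz hyz ht.1 ht.2.1 ht.2.2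
        refine Fintype.sum_equiv (Equiv.mulLeft g) _ _ fun σ => ?_
        simp [Equiv.Perm.mul_def]
    _ = ∑ σ : Equiv.Perm (Fin N), ∑ t ∈ distinctTriples N, F t.1 t.2.1 t.2.2 := by
        rw [Finset.sum_comm]
        refine Finset.sum_congr rfl fun σ _ => ?_
        refine Finset.sum_equiv (σ.symm.prodCongr (σ.symm.prodCongr σ.symm)) ?_ ?_
        · simp [distinctTriples]
        · simp
    _ = _ := by simp [Fintype.card_perm]

/-- Upper bound for the total of `firstReward` over the placements of the other two values, when
`n` positions remain after the first one. -/
noncomputable def firstBound (m : ℕ) (c u u' : ℝ) (n : ℕ) : ℝ :=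
  max (c * u * m * (m - 1) + n * (0.27 * u * (m - 1) + 0.46 * u * (n - 1)))
    (∑ r ∈ Finset.range n, max (0.27 * u' * (m - 1) + 0.46 * u' * r) (0.46 * (r : ℝ))
      + 0.46 * n * (n - 1) / 2)

lemma sum_Ioi_eq_sum_range {m : ℕ} (k : Fin (m + 1)) (f : ℕ → ℝ) :
    ∑ j ∈ Finset.Ioi k, f (m - j) = ∑ r ∈ Finset.range (m - k), f r := by
  refine Finset.sum_bij (fun j _ => m - (j : ℕ)) ?_ ?_ ?_ ?_
  · intro j hj
    simp only [Finset.mem_Ioi, Fin.lt_def, Finset.mem_range] at *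
    omega
  · intro a ha b hb h
    ext
    omega
  · intro r hr
    simp only [Finset.mem_range] at hr
    refine ⟨⟨m - r, by omega⟩, ?_, ?_⟩
    · simp only [Finset.mem_Ioi, Fin.lt_def]; omega
    · simp only; omega
  · simp

lemma sum_range_remaining (n : ℕ) :
    ∑ r ∈ Finset.range n, ((n : ℝ) - 1 - r) = n * (n - 1) / 2 := by
  have h : ∑ r ∈ Finset.range n, (r : ℝ) = n * (n - 1) / 2 := by
    induction n with
    | zero => simp
    | succ n ih => rw [Finset.sum_range_succ, ih]; push_cast; ring
  rw [Finset.sum_sub_distrib, h]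
  simp
  ring

lemma sum_ite_ne_ne {m : ℕ} {j k : Fin (m + 1)} (h : j ≠ k) :
    ∑ i : Fin (m + 1), (if i ≠ j ∧ i ≠ k then (1 : ℝ) else 0) = m - 1 := by
  have : (Finset.univ.filter fun i : Fin (m + 1) => i ≠ j ∧ i ≠ k)
      = (Finset.univ.erase j).erase k := by
    ext; simp [and_comm]
  rw [Finset.sum_boole, this, Finset.card_erase_of_mem (by simp [h.symm]),
    Finset.card_erase_of_mem (by simp)]
  have : 1 ≤ m := by
    have := j.2; have := k.2; have := Fin.val_ne_of_ne h; omega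
  simp [Nat.cast_sub this]

lemma sum_ite_gt {m : ℕ} (j : Fin (m + 1)) :
    ∑ i : Fin (m + 1), (if j < i then (1 : ℝ) else 0) = m - j := by
  rw [Finset.sum_boole, Finset.filter_lt_eq_Ioi, Fin.card_Ioi]
  simp [Nat.cast_sub (Fin.is_le j)]

lemma sum_ite_between {m : ℕ} {j k : Fin (m + 1)} (h : k < j) :
    ∑ i : Fin (m + 1), (if k < i ∧ i < j then (1 : ℝ) else 0) = j - k - 1 := by
  have : (Finset.univ.filter fun i : Fin (m + 1) => k < i ∧ i < j) = Finset.Ioo k j := by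
    ext; simp
  rw [Finset.sum_boole, this, Fin.card_Ioo, Nat.cast_sub, Nat.cast_sub]
  · simp
  · exact h.le
  · have := Fin.lt_def.1 h; omega

lemma sum_firstReward_of_lt {m : ℕ} (c u u' : ℝ) (p : Prop) (q : Fin (m + 1) → Prop)
    {j k : Fin (m + 1)} (h : k < j) {x₀ x₁ x₂ : ℝ}
    (h₁ : ∀ i, j < i → firstReward c u u' p q k i j = x₀ + x₁)
    (h₂ : ∀ i, k < i → i < j → firstReward c u u' p q k i j = x₀ + x₂)
    (h₃ : ∀ i, i < k → firstReward c u u' p q k i j = x₀) :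
    ∑ i, (if i ≠ j ∧ i ≠ k ∧ j ≠ k then firstReward c u u' p q k i j else 0)
      = x₀ * (m - 1) + x₁ * (m - j) + x₂ * (j - k - 1) := by
  rw [← sum_ite_ne_ne h.ne', ← sum_ite_gt j, ← sum_ite_between h, Finset.mul_sum, Finset.mul_sum,
    Finset.mul_sum, ← Finset.sum_add_distrib, ← Finset.sum_add_distrib]
  refine Finset.sum_congr rfl fun i _ => ?_
  rcases lt_trichotomy i k with hi | rfl | hi
  · simp [h₃ i hi, (hi.trans h).ne, hi.ne, h.ne', hi.not_gt, (hi.trans h).not_gt]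
  · simp [h.not_gt]
  · rcases lt_trichotomy i j with hj | rfl | hj
    · simp [h₂ i hi hj, hi.ne', hj.ne, h.ne', hi, hj, hj.not_gt]
    · simp
    · simp [h₁ i hj, hi.ne', hj.ne', h.ne', hj, hj.not_gt]

open Classical in
lemma sum_firstReward_le {m : ℕ} (c u u' : ℝ) (p : Prop) (q : Fin (m + 1) → Prop)
    (k : Fin (m + 1)) :
    ∑ j, ∑ i, (if i ≠ j ∧ i ≠ k ∧ j ≠ k then firstReward c u u' p q k i j else 0)
      ≤ firstBound m c u u' (m - k) := by
  have hk : ((m - k : ℕ) : ℝ) = m - k := Nat.cast_sub (Fin.is_le k)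
  by_cases hp : p
  · refine le_trans (le_of_eq ?_) (le_max_left _ _)
    have inner (j : Fin (m + 1)) :
        ∑ i, (if i ≠ j ∧ i ≠ k ∧ j ≠ k then firstReward c u u' p q k i j else 0)
          = (c * u * (m - 1)) * (if j ≠ k then 1 else 0)
            + (0.27 * u * (m - 1) + 0.46 * u * (m - k - 1)) * (if k < j then 1 else 0) := by
      rcases lt_trichotomy j k with h | rfl | h
      · rw [if_pos h.ne, if_neg h.not_gt, ← sum_ite_ne_ne h.ne, mul_zero, mul_one, add_zero,
          Finset.mul_sum]
        refine Finset.sum_congr rfl fun i _ => ?_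
        simp [firstReward, hp, h.not_gt, h.ne]
      · simp
      · rw [sum_firstReward_of_lt (x₀ := c * u + 0.27 * u) (x₁ := 0.46 * u) (x₂ := 0.46 * u)
          _ _ _ _ _ h, if_pos h.ne', if_pos h]
        · ring
        · intro i hi; simp [firstReward, hp, h, h.trans hi]
        · intro i hi _; simp [firstReward, hp, h, hi]
        · intro i hi; simp [firstReward, hp, h, hi.not_gt]
    simp only [inner]
    rw [Finset.sum_add_distrib, ← Finset.mul_sum, ← Finset.mul_sum, sum_ite_gt, hk]
    have : ∑ j : Fin (m + 1), (if j ≠ k then (1 : ℝ) else 0) = m := by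
      rw [Finset.sum_boole, Finset.filter_ne']
      simp
    rw [this]
    ring
  · refine le_trans ?_ (le_max_right _ _)
    have e : ∀ j : Fin (m + 1), (((m - (j : ℕ) : ℕ)) : ℝ) = m - j :=
      fun j => Nat.cast_sub (Fin.is_le j)
    calc _ ≤ ∑ j : Fin (m + 1), if k < j then
          (max (0.27 * u' * (m - 1) + 0.46 * u' * (m - j : ℕ)) (0.46 * ((m - j : ℕ) : ℝ))
            + 0.46 * ((m - k : ℕ) - 1 - (m - j : ℕ))) else 0 := by
          refine Finset.sum_le_sum fun j _ => ?_
          rcases lt_trichotomy j k with h | rfl | h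
          · rw [if_neg h.not_gt]
            refine Finset.sum_nonpos fun i _ => ?_
            simp [firstReward, hp, h.not_gt]
          · simp
          · rw [if_pos h, sum_firstReward_of_lt (x₀ := 0.27 * (if q j then u' else 0))
              (x₁ := 0.46 * (if q j then u' else 1)) (x₂ := 0.46) _ _ _ _ _ h, hk, e j]
            · by_cases hq : q j
              · simp only [hq, if_true]
                have := le_max_left (0.27 * u' * ((m : ℝ) - 1) + 0.46 * u' * (m - j))
                  (0.46 * ((m : ℝ) - j))
                linarith
              · simp only [hq, if_false]
                have := le_max_right (0.27 * u' * ((m : ℝ) - 1) + 0.46 * u' * (m - j))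
                  (0.46 * ((m : ℝ) - j))
                linarith
            · intro i hi; simp [firstReward, hp, h, h.trans hi, hi]
            · intro i hi hj; simp [firstReward, hp, h, hi, hj.not_gt]
            · intro i hi; simp [firstReward, hp, h, hi.not_gt]
      _ = _ := by
          rw [← Finset.sum_filter, Finset.filter_lt_eq_Ioi, sum_Ioi_eq_sum_range k fun r =>
            max (0.27 * u' * (m - 1) + 0.46 * u' * r) (0.46 * (r : ℝ))
            + 0.46 * ((m - k : ℕ) - 1 - r), Finset.sum_add_distrib, ← Finset.mul_sum,
            sum_range_remaining]
          ring

lemma sum_distinctTriples {N : ℕ} (F : Fin N → Fin N → Fin N → ℝ) :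
    ∑ t ∈ distinctTriples N, F t.1 t.2.1 t.2.2
      = ∑ i, ∑ j, ∑ k, if i ≠ j ∧ i ≠ k ∧ j ≠ k then F i j k else 0 := by
  rw [distinctTriples, Finset.sum_filter, Fintype.sum_prod_type]
  simp only [Fintype.sum_prod_type]

lemma sum_remaining {m : ℕ} (f : ℕ → ℝ) :
    ∑ k : Fin (m + 1), f (m - k) = ∑ n ∈ Finset.range (m + 1), f n := by
  rw [Fin.sum_univ_eq_sum_range (fun k => f (m - k)), ← Finset.sum_range_reflect f]
  simp

lemma sum_triple_firstReward_le {m : ℕ} (c u u' : ℝ) (p : Fin (m + 1) → Prop)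
    (q : Fin (m + 1) → Fin (m + 1) → Prop) :
    ∑ k, ∑ j, ∑ i, (if i ≠ j ∧ i ≠ k ∧ j ≠ k then firstReward c u u' (p k) (q k) k i j else 0)
      ≤ ∑ n ∈ Finset.range (m + 1), firstBound m c u u' n := by
  rw [← sum_remaining]
  exact Finset.sum_le_sum fun k _ => sum_firstReward_le ..

lemma card_distinctTriples (m : ℕ) :
    ((distinctTriples (m + 1)).card : ℝ) = (m + 1) * m * (m - 1) := by
  have h := sum_distinctTriples (N := m + 1) fun _ _ _ => 1
  simp only [Finset.sum_const, nsmul_eq_mul, mul_one] at h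
  have inner (i j : Fin (m + 1)) :
      ∑ k, (if i ≠ j ∧ i ≠ k ∧ j ≠ k then (1 : ℝ) else 0) = if j ≠ i then (m : ℝ) - 1 else 0 := by
    by_cases hij : i = j
    · simp [hij]
    · rw [if_pos (Ne.symm hij), ← sum_ite_ne_ne hij]
      simp [hij, eq_comm]
  rw [h]
  simp only [inner, Finset.sum_ite, Finset.filter_ne']
  simp
  ring

lemma sum_weighted_received_le {m : ℕ} (π : List ℝ → Bool) :
    ∑ t ∈ distinctTriples (m + 1), (0.46 * onlineReceived π (arrival₁ t.1 t.2.1 t.2.2)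
        + 0.27 * onlineReceived π (arrival₂ t.2.1 t.2.2)
        + 0.27 * onlineReceived π (arrivalSingle 0.38 t.2.2))
      ≤ ∑ n ∈ Finset.range (m + 1), firstBound m 0.27 0.38 0.59 n
        + ∑ n ∈ Finset.range (m + 1), firstBound m 0 0.59 0.38 n
        + ∑ n ∈ Finset.range (m + 1), firstBound m 0 0 0 n := by
  calc _ ≤ ∑ t ∈ distinctTriples (m + 1),
        (firstReward 0.27 0.38 0.59 (stopsAt π (arrivalSingle 0.38 t.2.2) t.2.2)
          (fun j => stopsAt π (arrival₂ j t.2.2) j) t.2.2 t.1 t.2.1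
        + firstReward 0 0.59 0.38 (stopsAt π (arrivalSingle 0.59 t.2.1) t.2.1)
          (fun k => stopsAt π (arrival₂ t.2.1 k) k) t.2.1 t.1 t.2.2
        + firstReward 0 0 0 False (fun _ => False) t.1 t.2.1 t.2.2) := by
        refine Finset.sum_le_sum fun t ht => ?_
        simp only [distinctTriples, Finset.mem_filter, Finset.mem_univ, true_and] at ht
        refine (weighted_received_le π ht.1 ht.2.1 ht.2.2).trans (le_of_eq ?_)
        simp [firstReward]
    _ ≤ _ := by
        rw [Finset.sum_add_distrib, Finset.sum_add_distrib]
        refine add_le_add (add_le_add ?_ ?_) ?_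
        · rw [sum_distinctTriples fun i j k => firstReward 0.27 0.38 0.59
            (stopsAt π (arrivalSingle 0.38 k) k) (fun j => stopsAt π (arrival₂ j k) j) k i j]
          refine le_trans (le_of_eq ?_) (sum_triple_firstReward_le _ _ _
            (fun k => stopsAt π (arrivalSingle 0.38 k) k) (fun k j => stopsAt π (arrival₂ j k) j))
          rw [Finset.sum_comm, Finset.sum_congr rfl fun _ _ => Finset.sum_comm, Finset.sum_comm]
        · rw [sum_distinctTriples fun i j k => firstReward 0 0.59 0.38
            (stopsAt π (arrivalSingle 0.59 j) j) (fun k => stopsAt π (arrival₂ j k) k) j i k]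
          refine le_trans (le_of_eq ?_) (sum_triple_firstReward_le _ _ _
            (fun j => stopsAt π (arrivalSingle 0.59 j) j) (fun j k => stopsAt π (arrival₂ j k) k))
          rw [Finset.sum_comm, Finset.sum_congr rfl fun _ _ => Finset.sum_comm]
          refine Finset.sum_congr rfl fun j _ => Finset.sum_congr rfl fun k _ =>
            Finset.sum_congr rfl fun i _ => if_congr ?_ rfl rfl
          grind
        · rw [sum_distinctTriples fun i j k => firstReward 0 0 0 False (fun _ => False) i j k]
          refine le_trans (le_of_eq ?_) (sum_triple_firstReward_le 0 0 0
            (fun _ => False) (fun _ _ => False))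
          rw [Finset.sum_congr rfl fun _ _ => Finset.sum_comm]
          refine Finset.sum_congr rfl fun i _ => Finset.sum_congr rfl fun k _ =>
            Finset.sum_congr rfl fun j _ => if_congr ?_ rfl rfl
          grind

lemma sum_range_le_add_sub {f : ℕ → ℝ} (Q : ℝ → ℝ) {s e : ℕ} (hse : s ≤ e)
    (h : ∀ n, s ≤ n → n < e → f n ≤ Q (n + 1) - Q n) :
    ∑ n ∈ Finset.range e, f n ≤ ∑ n ∈ Finset.range s, f n + (Q e - Q s) := by
  induction e, hse using Nat.le_induction with
  | base => simp
  | succ e hse ih =>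
    rw [Finset.sum_range_succ]
    have h₁ := ih fun n hn hn' => h n hn (by omega)
    have h₂ := h e hse (by omega)
    push_cast
    linarith

/-- Polynomial bound for the continuation sum in `firstBound` before the number of remaining
positions at which waiting for the value `1` becomes better than taking `u'`. -/
noncomputable def takePoly (u' x : ℝ) : ℝ :=
  0.27 * u' * 99998 * x + 0.46 * u' * x * (x - 1) / 2

lemma sum_max_le_takePoly {u' : ℝ} {R n : ℕ}
    (hR : ∀ r : ℝ, r + 1 ≤ R → 0.46 * r ≤ 0.27 * u' * 99998 + 0.46 * u' * r) (hn : n ≤ R) :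
    ∑ r ∈ Finset.range n, max (0.27 * u' * 99998 + 0.46 * u' * r) (0.46 * (r : ℝ))
      ≤ takePoly u' n := by
  have := sum_range_le_add_sub (f := fun r : ℕ =>
    max (0.27 * u' * 99998 + 0.46 * u' * r) (0.46 * (r : ℝ))) (takePoly u') (Nat.zero_le n) ?_
  · simpa [takePoly] using this
  · intro r _ hr
    rw [max_eq_left (hR r (by exact_mod_cast hr.trans_le hn))]
    apply le_of_eq
    unfold takePoly
    ring

lemma sum_max_le_waitPoly {u' : ℝ} {R n : ℕ}
    (hR : ∀ r : ℝ, r + 1 ≤ R → 0.46 * r ≤ 0.27 * u' * 99998 + 0.46 * u' * r)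
    (hR' : ∀ r : ℝ, R ≤ r → 0.27 * u' * 99998 + 0.46 * u' * r ≤ 0.46 * r) (hn : R ≤ n) :
    ∑ r ∈ Finset.range n, max (0.27 * u' * 99998 + 0.46 * u' * r) (0.46 * (r : ℝ))
      ≤ takePoly u' R + (0.23 * n * (n - 1) - 0.23 * R * (R - 1)) := by
  refine (sum_range_le_add_sub (fun x => 0.23 * x * (x - 1)) hn ?_).trans
    (add_le_add_left (sum_max_le_takePoly hR le_rfl) _)
  intro r hr _
  rw [max_eq_right (hR' r (by exact_mod_cast hr))]
  apply le_of_eq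
  ring

lemma sum_firstBound_low_le :
    ∑ n ∈ Finset.range 100000, firstBound 99999 0.27 0.38 0.59 n ≤ 0.2395 * 99999 * 99998 * 100000 := by
  have hR : ∀ r : ℝ, r + 1 ≤ (84463 : ℕ) →
      0.46 * r ≤ 0.27 * 0.59 * 99998 + 0.46 * 0.59 * r := by
    intro r hr; push_cast at hr; linarith
  have hR' : ∀ r : ℝ, (84463 : ℕ) ≤ r →
      0.27 * 0.59 * 99998 + 0.46 * 0.59 * r ≤ 0.46 * r := by
    intro r hr; push_cast at hr; linarith
  have e : ((99999 : ℕ) : ℝ) - 1 = 99998 := by norm_num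
  have b₁ := sum_range_le_add_sub (f := firstBound 99999 0.27 0.38 0.59) (s := 0) (e := 59950)
    (fun x => 0.27 * 0.38 * 99999 * 99998 * x + 0.27 * 0.38 * 99998 * x * (x - 1) / 2
      + 0.46 * 0.38 * x * (x - 1) * (x - 2) / 3) (by norm_num) ?_
  have b₂ := sum_range_le_add_sub (f := firstBound 99999 0.27 0.38 0.59) (s := 59950) (e := 84463)
    (fun x => 0.27 * 0.59 * 99998 * x * (x - 1) / 2
      + 0.46 * 1.59 * x * (x - 1) * (x - 2) / 6) (by norm_num) ?_
  have b₃ := sum_range_le_add_sub (f := firstBound 99999 0.27 0.38 0.59) (s := 84463) (e := 100000)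
    (fun x => (takePoly 0.59 84463 - 0.23 * 84463 * 84462) * x
      + 0.46 * x * (x - 1) * (x - 2) / 3) (by norm_num) ?_
  · simp only [takePoly] at b₁ b₂ b₃
    norm_num at b₁ b₂ b₃ ⊢
    linarith
  · intro n hn hn'
    have h := sum_max_le_waitPoly hR hR' hn
    have c₁ : (84463 : ℝ) ≤ n := by exact_mod_cast hn
    have c₂ : (n : ℝ) ≤ 99999 := by exact_mod_cast Nat.le_of_lt_succ hn'
    unfold firstBound
    rw [e]
    unfold takePoly at *
    push_cast at *
    refine max_le ?_ ?_
    · nlinarith [mul_nonneg (sub_nonneg.2 c₁) (sub_nonneg.2 c₂)]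
    · linarith
  · intro n hn hn'
    have h := sum_max_le_takePoly hR hn'.le
    have c₁ : (59950 : ℝ) ≤ n := by exact_mod_cast hn
    have c₂ : (n : ℝ) ≤ 84462 := by exact_mod_cast Nat.le_of_lt_succ hn'
    unfold firstBound
    rw [e]
    unfold takePoly at *
    push_cast at *
    refine max_le ?_ ?_
    · nlinarith [mul_nonneg (sub_nonneg.2 c₁) (sub_nonneg.2 c₂)]
    · linarith
  · intro n hn hn'
    have h := sum_max_le_takePoly (n := n) hR (by omega)
    have c₁ : (0 : ℝ) ≤ n := by exact_mod_cast hn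
    have c₂ : (n : ℝ) ≤ 59949 := by exact_mod_cast Nat.le_of_lt_succ hn'
    unfold firstBound
    rw [e]
    unfold takePoly at *
    push_cast at *
    refine max_le ?_ ?_
    · linarith
    · nlinarith [mul_nonneg (sub_nonneg.2 c₁) (sub_nonneg.2 c₂)]

lemma sum_firstBound_middle_le :
    ∑ n ∈ Finset.range 100000, firstBound 99999 0 0.59 0.38 n ≤ 0.1765 * 99999 * 99998 * 100000 := by
  have hR : ∀ r : ℝ, r + 1 ≤ (35975 : ℕ) →
      0.46 * r ≤ 0.27 * 0.38 * 99998 + 0.46 * 0.38 * r := by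
    intro r hr; push_cast at hr; linarith
  have hR' : ∀ r : ℝ, (35975 : ℕ) ≤ r →
      0.27 * 0.38 * 99998 + 0.46 * 0.38 * r ≤ 0.46 * r := by
    intro r hr; push_cast at hr; linarith
  have e : ((99999 : ℕ) : ℝ) - 1 = 99998 := by norm_num
  have b₁ := sum_range_le_add_sub (f := firstBound 99999 0 0.59 0.38) (s := 0) (e := 70605)
    (fun x => 0.27 * 0.59 * 99998 * x * (x - 1) / 2
      + 0.46 * 0.59 * x * (x - 1) * (x - 2) / 3) (by norm_num) ?_
  have b₂ := sum_range_le_add_sub (f := firstBound 99999 0 0.59 0.38) (s := 70605) (e := 100000)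
    (fun x => (takePoly 0.38 35975 - 0.23 * 35975 * 35974) * x
      + 0.46 * x * (x - 1) * (x - 2) / 3) (by norm_num) ?_
  · simp only [takePoly] at b₁ b₂
    norm_num at b₁ b₂ ⊢
    linarith
  · intro n hn hn'
    have h := sum_max_le_waitPoly (n := n) hR hR' (by omega)
    have c₁ : (70605 : ℝ) ≤ n := by exact_mod_cast hn
    have c₂ : (n : ℝ) ≤ 99999 := by exact_mod_cast Nat.le_of_lt_succ hn'
    unfold firstBound
    rw [e]
    unfold takePoly at *
    push_cast at *
    refine max_le ?_ ?_
    · nlinarith [mul_nonneg (sub_nonneg.2 c₁) (sub_nonneg.2 c₂)]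
    · linarith
  · intro n hn hn'
    have c₁ : (0 : ℝ) ≤ n := by exact_mod_cast hn
    have c₂ : (n : ℝ) ≤ 70604 := by exact_mod_cast Nat.le_of_lt_succ hn'
    unfold firstBound
    rw [e]
    refine max_le (by push_cast; linarith) ?_
    rcases le_total n 35975 with hnR | hnR
    · have h := sum_max_le_takePoly hR hnR
      have c₃ : (n : ℝ) ≤ 35975 := by exact_mod_cast hnR
      unfold takePoly at *
      push_cast at *
      nlinarith [mul_nonneg (sub_nonneg.2 c₁) (sub_nonneg.2 c₃)]
    · have h := sum_max_le_waitPoly hR hR' hnR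
      have c₃ : (35975 : ℝ) ≤ n := by exact_mod_cast hnR
      unfold takePoly at *
      push_cast at *
      nlinarith [mul_nonneg (sub_nonneg.2 c₂) (sub_nonneg.2 c₃)]

lemma sum_firstBound_high_le :
    ∑ n ∈ Finset.range 100000, firstBound 99999 0 0 0 n ≤ 0.46 / 3 * 99999 * 99998 * 100000 := by
  have b := sum_range_le_add_sub (f := firstBound 99999 0 0 0) (s := 0) (e := 100000)
    (fun x => 0.46 * x * (x - 1) * (x - 2) / 3) (by norm_num) ?_
  · norm_num at b ⊢
    linarith
  · intro n _ _
    have h := sum_max_le_waitPoly (u' := 0) (R := 0) (n := n) (fun r hr => by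
      push_cast at hr; linarith) (fun r hr => by push_cast at hr; linarith) (Nat.zero_le n)
    have e : ((99999 : ℕ) : ℝ) - 1 = 99998 := by norm_num
    unfold firstBound
    rw [e]
    unfold takePoly at h
    push_cast at *
    refine max_le ?_ ?_
    · have : (0 : ℝ) ≤ n * (n - 1) := by
        rcases n with _ | n
        · simp
        · push_cast; rw [add_sub_cancel_right]; positivity
      linarith
    · linarith

/-- The average reward over all arrival orders of `v` is the average over all triples of distinct
positions of three entries, when the sequence depends only on those positions. -/
lemma sum_perm_onlineReceived_div {m : ℕ} (hm : 2 ≤ m) (π : List ℝ → Bool)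
    (v : Fin (m + 1) → ℝ) {x y z : Fin (m + 1)} (hxy : x ≠ y) (hxz : x ≠ z) (hyz : y ≠ z)
    (a : Fin (m + 1) → Fin (m + 1) → Fin (m + 1) → Fin (m + 1) → ℝ)
    (h : ∀ σ : Equiv.Perm (Fin (m + 1)), v ∘ σ = a (σ.symm x) (σ.symm y) (σ.symm z)) :
    (∑ σ : Equiv.Perm (Fin (m + 1)), onlineReceived π (v ∘ σ)) / (Nat.factorial (m + 1))
      = (∑ t ∈ distinctTriples (m + 1), onlineReceived π (a t.1 t.2.1 t.2.2))
        / ((m + 1) * m * (m - 1)) := by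
  have hm' : (2 : ℝ) ≤ m := by exact_mod_cast hm
  have h₀ : ((m + 1) * m * (m - 1) : ℝ) ≠ 0 :=
    mul_ne_zero (mul_ne_zero (by linarith) (by linarith)) (by linarith)
  have key := card_mul_sum_perm hxy hxz hyz fun i j k => onlineReceived π (a i j k)
  rw [card_distinctTriples] at key
  simp only [h]
  rw [div_eq_div_iff (by positivity) h₀]
  linarith

lemma weighted_permRegret_ge {m : ℕ} (hm : 2 ≤ m) (π : List ℝ → Bool) :
    0.7219 - (∑ n ∈ Finset.range (m + 1), firstBound m 0.27 0.38 0.59 n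
        + ∑ n ∈ Finset.range (m + 1), firstBound m 0 0.59 0.38 n
        + ∑ n ∈ Finset.range (m + 1), firstBound m 0 0 0 n) / ((m + 1) * m * (m - 1)) ≤
      0.46 * permRegret (m := m) π
          (fun i => if (i : ℕ) = 0 then 1 else if (i : ℕ) = 1 then 0.59
            else if (i : ℕ) = 2 then 0.38 else 0)
      + 0.27 * permRegret (m := m) π
          (fun i => if (i : ℕ) = 0 then 0.59 else if (i : ℕ) = 1 then 0.38 else 0)
      + 0.27 * permRegret (m := m) π
          (fun i => if (i : ℕ) = 0 then 0.38 else 0) := by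
  have hm' : (2 : ℝ) ≤ m := by exact_mod_cast hm
  have h₀ : (0 : ℝ) ≤ (m + 1) * m * (m - 1) :=
    mul_nonneg (mul_nonneg (by linarith) (by linarith)) (by linarith)
  let x : Fin (m + 1) := ⟨0, by omega⟩
  let y : Fin (m + 1) := ⟨1, by omega⟩
  let z : Fin (m + 1) := ⟨2, by omega⟩
  have hxy : x ≠ y := by simp [x, y]
  have hxz : x ≠ z := by simp [x, z]
  have hyz : y ≠ z := by simp [y, z]
  have ex (i : Fin (m + 1)) : (i : ℕ) = 0 ↔ i = x := by rw [Fin.ext_iff]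
  have ey (i : Fin (m + 1)) : (i : ℕ) = 1 ↔ i = y := by rw [Fin.ext_iff]
  have ez (i : Fin (m + 1)) : (i : ℕ) = 2 ↔ i = z := by rw [Fin.ext_iff]
  simp only [ex, ey, ez]
  have avg₁ := sum_perm_onlineReceived_div hm π
    (fun i => if i = x then 1 else if i = y then 0.59 else if i = z then 0.38 else 0)
    hxy hxz hyz arrival₁ (fun σ => by
      ext s; simp [arrival₁, Equiv.eq_symm_apply])
  have avg₂ := sum_perm_onlineReceived_div hm π
    (fun i => if i = x then 0.59 else if i = y then 0.38 else 0)
    hxz.symm hyz.symm hxy (fun _ j k => arrival₂ j k) (fun σ => by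
      ext s; simp [arrival₂, Equiv.eq_symm_apply])
  have avg₃ := sum_perm_onlineReceived_div hm π (fun i => if i = x then 0.38 else 0)
    hyz hxy.symm hxz.symm (fun _ _ k => arrivalSingle 0.38 k) (fun σ => by
      ext s; simp [arrivalSingle, Equiv.eq_symm_apply])
  have max_ge (v : Fin (m + 1) → ℝ) : v x ≤ Finset.univ.sup' Finset.univ_nonempty v :=
    Finset.le_sup' v (Finset.mem_univ x)
  have M₁ := max_ge (fun i => if i = x then 1 else if i = y then 0.59 else if i = z then 0.38 else 0)
  have M₂ := max_ge (fun i => if i = x then 0.59 else if i = y then 0.38 else 0)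
  have M₃ := max_ge (fun i => if i = x then 0.38 else 0)
  simp only [if_true] at M₁ M₂ M₃
  have total := div_le_div_of_nonneg_right (sum_weighted_received_le (m := m) π) h₀
  rw [Finset.sum_add_distrib, Finset.sum_add_distrib, ← Finset.mul_sum, ← Finset.mul_sum,
    ← Finset.mul_sum, add_div, add_div, mul_div_assoc, mul_div_assoc, mul_div_assoc, ← avg₁,
    ← avg₂, ← avg₃] at total
  unfold permRegret
  linarith

/-- With `M = 100000`, for the three value vectors
`v⁽¹⁾ = (1, 0.59, 0.38, 0, …, 0)`, `v⁽²⁾ = (0.59, 0.38, 0, …, 0)`, `v⁽³⁾ = (0.38, 0, …, 0)`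
of length `M`, every deterministic online selection rule `π` satisfies
`0.46·R(v⁽¹⁾) + 0.27·R(v⁽²⁾) + 0.27·R(v⁽³⁾) ≥ 0.152`, where `R` denotes the expected
regret under a uniformly random arrival order. -/
theorem secretary_regret_lower_bound (π : List ℝ → Bool) :
    0.152 ≤
      0.46 * permRegret (m := 99999) π
          (fun i => if (i : ℕ) = 0 then 1 else if (i : ℕ) = 1 then 0.59
            else if (i : ℕ) = 2 then 0.38 else 0)
      + 0.27 * permRegret (m := 99999) π
          (fun i => if (i : ℕ) = 0 then 0.59 else if (i : ℕ) = 1 then 0.38 else 0)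
      + 0.27 * permRegret (m := 99999) π
          (fun i => if (i : ℕ) = 0 then 0.38 else 0) := by
  refine le_trans ?_ (weighted_permRegret_ge (Nat.le_of_ble_eq_true rfl) π)
  have h₁ := sum_firstBound_low_le
  have h₂ := sum_firstBound_middle_le
  have h₃ := sum_firstBound_high_le
  rw [le_sub_comm, div_le_iff₀ (by norm_num)]
  norm_num at h₁ h₂ h₃ ⊢
  linarith
end
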